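/- arXiv:math/0411308 — 2 statements merged into one kernel-verified Lean document; each statement's English description precedes it below -/
import Mathlib

section
/- Let W ⊂ ℂⁿ be a uniformly flat smooth closed complex hypersurface with tubular neighborhood radius ε₀, let 0 < p ≤ ∞, let 0 < ε < ε₀/2, and let φ be a C² plurisubharmonic function on ℂⁿ with i∂∂̄φ ≤ Mω. Then there is a constant C > 0, depending only on ε₀, ε, p and M, such that for each w ∈ W and each holomorphic function f on B(w,2ε) ∩ W there exists a holomorphic function F on B(w,ε) with F = f on B(w,ε) ∩ W and ∫_{B(w,ε)} |F|^p e^{-pφ} dV ≤ C ∫_{W∩B(w,2ε)} |f|^p e^{-pφ} dσ (suprema in place of the integrals when p = ∞). -/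
open MeasureTheory Metric Set
open scoped ENNReal NNReal Topology

noncomputable section

/-- `ℂⁿ` with the Euclidean (Hermitian) norm. -/
abbrev En (n : ℕ) : Type := EuclideanSpace ℂ (Fin n)

instance (n : ℕ) : MeasurableSpace (En n) := borel _
instance (n : ℕ) : BorelSpace (En n) := ⟨rfl⟩

/-- Lebesgue measure on `ℂⁿ ≅ ℝ^{2n}`, realized as `2n`-dimensional Hausdorff measure. -/
def vol (n : ℕ) : Measure (En n) := μH[(2 * n : ℝ)]

/-- The surface measure `dσ` on a hypersurface `W` induced by `ω^{n-1}`: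
a constant multiple of `(2n-2)`-dimensional Hausdorff measure restricted to `W`. -/
def surf (n : ℕ) (W : Set (En n)) : Measure (En n) :=
  ((2 : ℝ≥0∞) ^ (n - 1) * (Nat.factorial (n - 1) : ℝ≥0∞)) •
    (μH[(2 * n - 2 : ℝ)] : Measure (En n)).restrict W

open Classical in
/-- The weighted `L^p`-"norm" (to the `p`-th power for `p < ∞`) of `F` over the set `S`
with respect to the measure `μ` and the weight `φ`; for `p = ∞` it is the weighted sup. -/
def wNorm {n : ℕ} (p : ℝ≥0∞) (φ : En n → ℝ) (μ : Measure (En n)) (S : Set (En n))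
    (F : En n → ℂ) : ℝ≥0∞ :=
  if p = ⊤ then ⨆ z ∈ S, ENNReal.ofReal (‖F z‖ * Real.exp (-φ z))
  else ∫⁻ z in S, ENNReal.ofReal (‖F z‖ ^ p.toReal * Real.exp (-(p.toReal * φ z))) ∂μ

/-- Real Hessian of `φ` at `z` in the directions `u`, `v`. -/
def hess {n : ℕ} (φ : En n → ℝ) (z u v : En n) : ℝ := fderiv ℝ (fderiv ℝ φ) z u v

/-- The Levi form `i∂∂̄φ(z)(v,v̄) = Σ φ_{j k̄}(z) v_j v̄_k`, expressed through the
real Hessian.  For `φ = ‖z‖²` it equals `‖v‖²`, i.e. `ω = i∂∂̄‖z‖²` corresponds to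
`levi = ‖v‖²`. -/
def levi {n : ℕ} (φ : En n → ℝ) (z v : En n) : ℝ :=
  (hess φ z v v + hess φ z (Complex.I • v) (Complex.I • v)) / 4

/-- `W` is uniformly flat with tubular radius `ε₀`: the neighborhood
`N_{ε₀}(W)` is a tubular neighborhood, i.e. every point of it has a unique nearest
point on `W` and the (smooth) nearest-point projection `pr` is well defined there. -/
def UniformlyFlatWith {n : ℕ} (ε₀ : ℝ) (W : Set (En n)) : Prop :=
  0 < ε₀ ∧ ∃ pr : En n → En n,
    ContDiffOn ℝ (⊤ : ℕ∞) pr {z | Metric.infDist z W < ε₀} ∧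
    ∀ z : En n, Metric.infDist z W < ε₀ →
      pr z ∈ W ∧ dist z (pr z) = Metric.infDist z W ∧
        ∀ w ∈ W, dist z w = Metric.infDist z W → w = pr z

/-- `W` is uniformly flat. -/
def UniformlyFlat {n : ℕ} (W : Set (En n)) : Prop := ∃ ε₀, UniformlyFlatWith ε₀ W

/-- `f` is holomorphic on the complex submanifold `W`: near every point of `W` it is
the restriction of some holomorphic function of the ambient space. -/
def HolOn {n : ℕ} (W : Set (En n)) (f : En n → ℂ) : Prop :=
  ∀ w ∈ W, ∃ U ∈ 𝓝 w, ∃ g : En n → ℂ, DifferentiableOn ℂ g U ∧ Set.EqOn f g (U ∩ W)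

/-- The average `φ_r` of `φ` over the ball `B(z,r)`. -/
def avgBall {n : ℕ} (φ : En n → ℝ) (r : ℝ) (z : En n) : ℝ :=
  ((vol n) (Metric.ball z r)).toReal⁻¹ * ∫ x in Metric.ball z r, φ x ∂(vol n)

/-- The averaged current of integration `Υ_W(z,r)(v,v̄)`: by Lelong–Poincaré,
`Υ_W(z,r)(v,v) = (π / vol B(z,r)) ∫_{W ∩ B(z,r)} |⟨v, n_w⟩|² dσ(w)`, where the unit
normal pairing is `|⟨v, n_w⟩| = ‖dT_w(v)‖ / ‖dT_w‖` for a defining function `T` of `W`. -/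
def Upsilon {n : ℕ} (T : En n → ℂ) (W : Set (En n)) (r : ℝ) (z v : En n) : ℝ :=
  (Real.pi / ((vol n) (Metric.ball z r)).toReal) *
    ∫ w in Metric.ball z r, (‖fderiv ℂ T w v‖ / ‖fderiv ℂ T w‖) ^ 2 ∂(surf n W)

/-- `f` is holomorphic on the piece `S ∩ W` of the complex submanifold `W`: near every
point of `S ∩ W` it is the restriction of an ambient holomorphic function. -/
def HolOnPiece {n : ℕ} (W S : Set (En n)) (f : En n → ℂ) : Prop :=
  ∀ x ∈ S ∩ W, ∃ U ∈ 𝓝 x, ∃ g : En n → ℂ, DifferentiableOn ℂ g U ∧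
    Set.EqOn f g (U ∩ (S ∩ W))

section ParametricIntegral

variable {𝕜 H E P : Type*} [RCLike 𝕜] [NormedAddCommGroup H] [NormedSpace 𝕜 H]
  [NormedAddCommGroup E] [NormedSpace ℝ E] [NormedSpace 𝕜 E]
  [TopologicalSpace P] [CompactSpace P]

/-- A function of two variables, continuous along a compact slice, is bounded near that slice. -/
theorem exists_nhds_norm_le_of_continuousOn {X F : Type*} [TopologicalSpace X]
    [NormedAddCommGroup F] {G : X → P → F} {U : Set X} (hU : IsOpen U)
    (hG : ContinuousOn (Function.uncurry G) (U ×ˢ univ)) {x₀ : X} (hx₀ : x₀ ∈ U) :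
    ∃ C : ℝ, ∃ s ∈ 𝓝 x₀, s ⊆ U ∧ ∀ x ∈ s, ∀ a, ‖G x a‖ ≤ C := by
  have hc : Continuous fun a => G x₀ a :=
    hG.comp_continuous (f := fun a => (x₀, a)) (by fun_prop) (fun a => ⟨hx₀, mem_univ _⟩)
  obtain ⟨C, hC⟩ := (isCompact_univ (X := P)).exists_bound_of_continuousOn hc.continuousOn
  have hev : ∀ a ∈ (univ : Set P), ∀ᶠ z : X × P in 𝓝 (x₀, a),
      z.1 ∈ U ∧ ‖Function.uncurry G z‖ < C + 1 := by
    intro a _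
    have h1 : ∀ᶠ z : X × P in 𝓝 (x₀, a), z ∈ U ×ˢ (univ : Set P) :=
      (hU.prod isOpen_univ).mem_nhds ⟨hx₀, mem_univ _⟩
    have h2 := (hG.continuousAt h1).norm.eventually_lt_const
      (show ‖Function.uncurry G (x₀, a)‖ < C + 1 by have := hC a (mem_univ _); simp; linarith)
    filter_upwards [h1, h2] with z hz1 hz2 using ⟨hz1.1, hz2⟩
  have := isCompact_univ.eventually_forall_of_forall_eventually
    (P := fun x a => x ∈ U ∧ ‖G x a‖ < C + 1) (x₀ := x₀) hev
  have hxU : ∀ᶠ x in 𝓝 x₀, x ∈ U := hU.mem_nhds hx₀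
  exact ⟨C + 1, {x | x ∈ U ∧ ∀ a, ‖G x a‖ ≤ C + 1},
    by filter_upwards [this, hxU] with x hx hx' using ⟨hx', fun a => (hx a (mem_univ _)).2.le⟩,
    fun x hx => hx.1, fun x hx => hx.2⟩

variable [MeasurableSpace P] [OpensMeasurableSpace P] [SecondCountableTopology P]

/-- Differentiation under the integral over a compact parameter space. -/
theorem hasFDerivAt_integral_of_compact {μ : Measure P} [IsFiniteMeasure μ]
    {F : H → P → E} {F' : H → P → H →L[𝕜] E} {U : Set H} (hU : IsOpen U)
    (hF : ∀ x ∈ U, Continuous (F x))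
    (hF' : ContinuousOn (Function.uncurry F') (U ×ˢ univ))
    (hd : ∀ x ∈ U, ∀ a, HasFDerivAt (F · a) (F' x a) x) {x₀ : H} (hx₀ : x₀ ∈ U) :
    HasFDerivAt (fun x => ∫ a, F x a ∂μ) (∫ a, F' x₀ a ∂μ) x₀ := by
  obtain ⟨C, s, hs, hsU, hC⟩ := exists_nhds_norm_le_of_continuousOn hU hF' hx₀
  have hc : Continuous fun a => F' x₀ a :=
    hF'.comp_continuous (f := fun a => (x₀, a)) (by fun_prop) (fun a => ⟨hx₀, mem_univ _⟩)
  refine hasFDerivAt_integral_of_dominated_of_fderiv_le (bound := fun _ => C) hs ?_ ?_ ?_ ?_ ?_ ?_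
  · filter_upwards [hU.mem_nhds hx₀] with x hx using (hF x hx).aestronglyMeasurable
  · obtain ⟨D, hD⟩ := (isCompact_univ (X := P)).exists_bound_of_continuousOn
      (hF x₀ hx₀).continuousOn
    exact Integrable.of_bound (hF x₀ hx₀).aestronglyMeasurable D
      (Filter.Eventually.of_forall fun a => hD a (mem_univ _))
  · exact hc.aestronglyMeasurable
  · exact Filter.Eventually.of_forall fun a x hx => hC x hx a
  · exact integrable_const _
  · exact Filter.Eventually.of_forall fun a x hx => hd x (hsU hx) a

/-- One-variable version of `hasFDerivAt_integral_of_compact`. -/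
theorem hasDerivAt_integral_of_compact {μ : Measure P} [IsFiniteMeasure μ]
    {F F' : ℝ → P → E} (hF : ∀ x, Continuous (F x)) (hF' : Continuous (Function.uncurry F'))
    (hd : ∀ x a, HasDerivAt (F · a) (F' x a) x) (x₀ : ℝ) :
    HasDerivAt (fun x => ∫ a, F x a ∂μ) (∫ a, F' x₀ a ∂μ) x₀ := by
  obtain ⟨C, s, hs, -, hC⟩ := exists_nhds_norm_le_of_continuousOn isOpen_univ
    hF'.continuousOn (mem_univ x₀)
  refine (hasDerivAt_integral_of_dominated_loc_of_deriv_le (bound := fun _ => C) hs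
    (Filter.Eventually.of_forall fun x => (hF x).aestronglyMeasurable) ?_ ?_
    (Filter.Eventually.of_forall fun a x hx => hC x hx a) (integrable_const _)
    (Filter.Eventually.of_forall fun a x _ => hd x a)).2
  · obtain ⟨D, hD⟩ := (isCompact_univ (X := P)).exists_bound_of_continuousOn (hF x₀).continuousOn
    exact Integrable.of_bound (hF x₀).aestronglyMeasurable D
      (Filter.Eventually.of_forall fun a => hD a (mem_univ _))
  · exact (show Continuous fun a => F' x₀ a by fun_prop).aestronglyMeasurable

end ParametricIntegral

section CauchyKernel

variable {n : ℕ}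

/-- The point of the torus of radius `R` with angles `2π θ i`. -/
def torusPt (R : ℝ) (θ : Fin n → UnitAddCircle) : En n :=
  WithLp.toLp 2 fun i => (R : ℂ) * (AddCircle.toCircle (θ i) : ℂ)

/-- The Cauchy kernel of the polydisc of radius `R`, normalized by Haar measure on the torus. -/
def cauchyKer (R : ℝ) (z : En n) (θ : Fin n → UnitAddCircle) : ℂ :=
  ∏ i, torusPt R θ i / (torusPt R θ i - z i)

theorem torusPt_apply (R : ℝ) (θ : Fin n → UnitAddCircle) (i : Fin n) :
    torusPt R θ i = (R : ℂ) * (AddCircle.toCircle (θ i) : ℂ) := rfl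

theorem norm_torusPt_apply {R : ℝ} (hR : 0 ≤ R) (θ : Fin n → UnitAddCircle) (i : Fin n) :
    ‖torusPt R θ i‖ = R := by
  rw [torusPt_apply, norm_mul, Circle.norm_coe, mul_one, Complex.norm_real, Real.norm_of_nonneg hR]

theorem continuous_torusPt (R : ℝ) : Continuous (torusPt (n := n) R) := by
  refine (PiLp.continuous_toLp 2 _).comp (continuous_pi fun i => continuous_const.mul ?_)
  exact continuous_subtype_val.comp (AddCircle.continuous_toCircle.comp (continuous_apply i))

theorem torusPt_sub_ne_zero {R : ℝ} (hR : 0 ≤ R) {θ : Fin n → UnitAddCircle} {i : Fin n} {a : ℂ}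
    (ha : ‖a‖ < R) : torusPt R θ i - a ≠ 0 := by
  intro h
  rw [sub_eq_zero] at h
  rw [← h, norm_torusPt_apply hR] at ha
  exact lt_irrefl _ ha

theorem continuous_kernel_apply {R : ℝ} (hR : 0 ≤ R) {a : ℂ} (ha : ‖a‖ < R) (i : Fin n) :
    Continuous fun θ : Fin n → UnitAddCircle => torusPt R θ i / (torusPt R θ i - a) := by
  have h : Continuous fun θ : Fin n → UnitAddCircle => torusPt R θ i :=
    (PiLp.continuous_apply 2 _ i).comp (continuous_torusPt R)
  exact h.div (h.sub continuous_const) fun θ => torusPt_sub_ne_zero hR ha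

theorem norm_kernel_le {r : ℝ} (hr : 0 < r) {a : ℂ} (ha : ‖a‖ ≤ r) (θ : Fin n → UnitAddCircle)
    (i : Fin n) : ‖torusPt (2 * r) θ i / (torusPt (2 * r) θ i - a)‖ ≤ 2 := by
  have h1 := norm_torusPt_apply (by positivity : 0 ≤ 2 * r) θ i
  have h2 := norm_sub_norm_le (torusPt (2 * r) θ i) a
  rw [norm_div, h1, div_le_iff₀ (by linarith)]
  linarith

theorem integral_kernel_eq_one {R : ℝ} {a : ℂ} (ha : ‖a‖ < R) :
    ∫ t : UnitAddCircle, (R : ℂ) * (AddCircle.toCircle t : ℂ) /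
      ((R : ℂ) * (AddCircle.toCircle t : ℂ) - a) = 1 := by
  have h := circleIntegral.integral_sub_inv_of_mem_ball (c := 0) (R := R) (w := a) (by simpa using ha)
  rw [circleIntegral] at h
  rw [← UnitAddCircle.intervalIntegral_preimage 0]
  have h2 := intervalIntegral.integral_comp_mul_left
    (fun θ => deriv (circleMap 0 R) θ • (circleMap 0 R θ - a)⁻¹) (a := 0) (b := 1)
    (c := 2 * Real.pi) (by positivity)
  simp only [mul_zero, mul_one] at h2
  rw [h] at h2
  have h3 : ∀ x : ℝ, deriv (circleMap 0 R) (2 * Real.pi * x) •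
      (circleMap 0 R (2 * Real.pi * x) - a)⁻¹ = Complex.I *
      ((R : ℂ) * (AddCircle.toCircle (x : UnitAddCircle) : ℂ) /
      ((R : ℂ) * (AddCircle.toCircle (x : UnitAddCircle) : ℂ) - a)) := by
    intro x
    have : circleMap 0 R (2 * Real.pi * x) = (R : ℂ) * (AddCircle.toCircle (x : UnitAddCircle) : ℂ) := by
      rw [AddCircle.toCircle_apply_mk, circleMap_zero, Circle.coe_exp]
      congr 3
      push_cast; ring
    rw [deriv_circleMap, this, smul_eq_mul]
    ring
  simp only [h3, intervalIntegral.integral_const_mul] at h2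
  have h4 : Complex.I ≠ 0 := Complex.I_ne_zero
  rw [zero_add]
  have hpi : (Real.pi : ℂ) ≠ 0 := by exact_mod_cast Real.pi_ne_zero
  refine mul_left_cancel₀ h4 (h2.trans ?_)
  rw [Complex.real_smul]
  push_cast
  field_simp

theorem integral_cauchyKer {R : ℝ} {z : En n} (hz : ∀ i, ‖z i‖ < R) :
    ∫ θ, cauchyKer R z θ = 1 := by
  simp only [cauchyKer, torusPt_apply]
  rw [integral_fintype_prod_volume_eq_prod (fun i t => (R : ℂ) * (AddCircle.toCircle t : ℂ) /
      ((R : ℂ) * (AddCircle.toCircle t : ℂ) - z i))]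
  simp [integral_kernel_eq_one (hz _)]

/-- Rotating one angle of the torus moves the torus point along one complex coordinate. -/
theorem torusPt_add_single (R : ℝ) (θ : Fin n → UnitAddCircle) (j : Fin n) (α : ℝ) :
    torusPt R (θ + Pi.single j (α : UnitAddCircle)) =
      torusPt R θ + ((Complex.exp (2 * Real.pi * α * Complex.I) - 1) * torusPt R θ j) •
        EuclideanSpace.single j (1 : ℂ) := by
  ext i
  by_cases h : i = j
  · subst h
    simp [torusPt_apply, AddCircle.toCircle_add, AddCircle.toCircle_apply_mk, Circle.coe_exp]
    ring
  · simp [torusPt_apply, h]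

end CauchyKernel

section CauchyApprox

variable {n : ℕ}

/-- Rotation invariance of the torus measure, in infinitesimal form. -/
theorem integral_fderiv_rotation_eq_zero (R : ℝ) {v : En n → ℂ} (hv : ContDiff ℝ 1 v) (j : Fin n)
    {κ : (Fin n → UnitAddCircle) → ℂ} (hκ : Continuous κ)
    (hκj : ∀ θ (t : UnitAddCircle), κ (θ + Pi.single j t) = κ θ) :
    ∫ θ, fderiv ℝ v (torusPt R θ) ((Complex.I * torusPt R θ j) • EuclideanSpace.single j (1 : ℂ))
      * κ θ = 0 := by
  set c : ℝ → ℂ := fun α => Complex.exp (2 * Real.pi * α * Complex.I) with hc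
  have hcc : Continuous c := by fun_prop
  have hcd : ∀ α, HasDerivAt c (2 * Real.pi * Complex.I * c α) α := by
    intro α
    have h1 : HasDerivAt (fun α : ℝ => (2 * Real.pi * α * Complex.I : ℂ))
        (2 * Real.pi * Complex.I) α := by
      have := ((Complex.ofRealCLM.hasDerivAt (x := α)).const_mul (2 * Real.pi : ℂ)).mul_const
        Complex.I
      simpa using this
    convert h1.cexp using 1
    simp only [hc]; ring
  have hζ := continuous_torusPt (n := n) R
  have hζj : Continuous fun θ : Fin n → UnitAddCircle => torusPt R θ j :=
    (PiLp.continuous_apply 2 _ j).comp hζ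
  set X : ℝ → (Fin n → UnitAddCircle) → En n := fun α θ =>
    torusPt R θ + ((c α - 1) * torusPt R θ j) • EuclideanSpace.single j (1 : ℂ) with hX
  have hXc : Continuous (Function.uncurry X) := by
    simp only [hX, Function.uncurry_def]
    fun_prop
  have hdv : Continuous (fderiv ℝ v) := hv.continuous_fderiv (by norm_num)
  have hkey := hasDerivAt_integral_of_compact (μ := (volume : Measure (Fin n → UnitAddCircle)))
    (F := fun α θ => v (X α θ) * κ θ)
    (F' := fun α θ => fderiv ℝ v (X α θ)
      ((2 * Real.pi * Complex.I * c α * torusPt R θ j) • EuclideanSpace.single j (1 : ℂ)) * κ θ)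
    (fun α => (hv.continuous.comp (hXc.comp (by fun_prop : Continuous fun θ => (α, θ)))).mul hκ)
    (by
      have h1 : Continuous fun q : ℝ × (Fin n → UnitAddCircle) => fderiv ℝ v (X q.1 q.2) :=
        hdv.comp hXc
      have h2 : Continuous fun q : ℝ × (Fin n → UnitAddCircle) =>
          (2 * Real.pi * Complex.I * c q.1 * torusPt R q.2 j) •
            (EuclideanSpace.single j (1 : ℂ) : En n) := by fun_prop
      exact (h1.clm_apply h2).mul (hκ.comp continuous_snd))
    (fun α θ => by
      have h1 : HasDerivAt (fun α => X α θ)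
          ((2 * Real.pi * Complex.I * c α * torusPt R θ j) • EuclideanSpace.single j (1 : ℂ)) α :=
        ((((hcd α).sub_const 1).mul_const (torusPt R θ j)).smul_const _).const_add _
      exact (((hv.differentiable (by norm_num)) _).hasFDerivAt.comp_hasDerivAt α h1).mul_const _) 0
  have hconst : (fun α => ∫ θ, v (X α θ) * κ θ) = fun _ => ∫ θ, v (torusPt R θ) * κ θ := by
    funext α
    rw [← integral_add_right_eq_self (fun θ => v (torusPt R θ) * κ θ)
      (Pi.single j (α : UnitAddCircle))]
    simp only [torusPt_add_single, hκj, hX, hc]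
  rw [hconst] at hkey
  have h0 := hkey.unique (hasDerivAt_const _ _)
  have hX0 : ∀ θ, X 0 θ = torusPt R θ := fun θ => by simp [hX, hc]
  have hc0 : c 0 = 1 := by simp [hc]
  have hpi : (2 * Real.pi : ℝ) ≠ 0 := by positivity
  have h1 : ∀ θ, fderiv ℝ v (X 0 θ)
      ((2 * Real.pi * Complex.I * c 0 * torusPt R θ j) • EuclideanSpace.single j (1 : ℂ)) * κ θ
      = (2 * Real.pi : ℝ) • (fderiv ℝ v (torusPt R θ)
      ((Complex.I * torusPt R θ j) • EuclideanSpace.single j (1 : ℂ)) * κ θ) := by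
    intro θ
    rw [hX0, hc0, ← smul_mul_assoc, ← map_smul]
    congr 2
    rw [← Complex.coe_smul, smul_smul]
    congr 1
    push_cast; ring
  simp only [h1] at h0
  rw [integral_smul, smul_eq_zero] at h0
  exact h0.resolve_left hpi

/-- The antiholomorphic part of a real-linear map of `ℂ` is all that survives in the
combination produced by the Cauchy kernel. -/
theorem norm_kernel_combination_le (D : ℂ →L[ℝ] ℂ) {A r : ℝ} (a b : ℂ) (hb : b ≠ 0)
    (hA : ‖D 1 + Complex.I * D Complex.I‖ ≤ 2 * A)
    (hab : ‖a / b‖ ≤ 2) (ha : ‖a‖ ≤ 2 * r) (hbr : ‖b‖ ≤ 3 * r) :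
    ‖D b * (a / b) + Complex.I * D (Complex.I * a)‖ ≤ 8 * r * A := by
  have hD : ∀ c : ℂ, D c = (D 1 - Complex.I * D Complex.I) / 2 * c +
      (D 1 + Complex.I * D Complex.I) / 2 * (starRingEnd ℂ) c := by
    intro c
    have h1 : D c = c.re * D 1 + c.im * D Complex.I := by
      conv_lhs => rw [← Complex.re_add_im c]
      rw [map_add]
      have e1 : ((c.re : ℂ)) = c.re • (1 : ℂ) := by simp
      have e2 : ((c.im : ℂ)) * Complex.I = c.im • Complex.I := by simp
      rw [e1, e2, map_smul, map_smul]
      simp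
    have h2 : (starRingEnd ℂ) c = c.re - c.im * Complex.I := by
      apply Complex.ext <;> simp
    have h3 : c = c.re + c.im * Complex.I := (Complex.re_add_im c).symm
    rw [h1, h2]
    conv_rhs => rw [h3]
    simp only [Complex.add_re, Complex.ofReal_re, Complex.mul_re, Complex.I_re, mul_zero,
      Complex.ofReal_im, Complex.I_im, mul_one, sub_self, add_zero, Complex.add_im, Complex.mul_im,
      zero_add]
    linear_combination (c.im * D Complex.I) * Complex.I_sq
  set p := (D 1 + Complex.I * D Complex.I) / 2 with hp
  have hpA : ‖p‖ ≤ A := by rw [hp, norm_div]; simp; linarith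
  have h4 : D b * (a / b) + Complex.I * D (Complex.I * a) =
      p * ((starRingEnd ℂ) b * (a / b) + (starRingEnd ℂ) a) := by
    rw [hD b, hD (Complex.I * a), map_mul, Complex.conj_I]
    have hb' : b * (a / b) = a := mul_div_cancel₀ a hb
    linear_combination ((D 1 - Complex.I * D Complex.I) / 2) * (hb' + a * Complex.I_sq)
      - p * (starRingEnd ℂ) a * Complex.I_sq
  rw [h4, norm_mul]
  have h5 : ‖(starRingEnd ℂ) b * (a / b) + (starRingEnd ℂ) a‖ ≤ 8 * r := by
    refine (norm_add_le _ _).trans ?_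
    rw [norm_mul, RCLike.norm_conj, RCLike.norm_conj]
    nlinarith [norm_nonneg b, norm_nonneg (a / b)]
  have hA0 : 0 ≤ A := (norm_nonneg _).trans hpA
  calc ‖p‖ * ‖(starRingEnd ℂ) b * (a / b) + (starRingEnd ℂ) a‖ ≤ A * (8 * r) := by gcongr
    _ = _ := by ring

theorem norm_deriv_cauchy_homotopy_le {r A : ℝ} (hr : 0 < r) {z : En n} (hz : ∀ i, ‖z i‖ ≤ r)
    {u : En n → ℂ} (hu : ContDiff ℝ 1 u)
    (hA : ∀ x (j : Fin n), ‖fderiv ℝ u x (EuclideanSpace.single j 1) +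
      Complex.I * fderiv ℝ u x (Complex.I • EuclideanSpace.single j 1)‖ ≤ 2 * A)
    {s : ℝ} (hs : s ≠ 0) :
    ‖∫ θ, fderiv ℝ u (z + s • (torusPt (2 * r) θ - z)) (torusPt (2 * r) θ - z) *
      cauchyKer (2 * r) z θ‖ ≤ n * (8 * r * A * 2 ^ n) := by
  set R := 2 * r with hR
  have hR0 : 0 ≤ R := by positivity
  have hzR : ∀ i, ‖z i‖ < R := fun i => (hz i).trans_lt (by linarith)
  set k : Fin n → (Fin n → UnitAddCircle) → ℂ :=
    fun i θ => torusPt R θ i / (torusPt R θ i - z i) with hk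
  have hkc : ∀ i, Continuous (k i) := fun i => continuous_kernel_apply hR0 (hzR i) i
  set κ : Fin n → (Fin n → UnitAddCircle) → ℂ := fun j θ => ∏ i ∈ Finset.univ.erase j, k i θ with hκ
  have hκc : ∀ j, Continuous (κ j) := fun j => continuous_finsetProd _ fun i _ => hkc i
  have hKκ : ∀ j θ, cauchyKer R z θ = k j θ * κ j θ := fun j θ =>
    (Finset.mul_prod_erase Finset.univ (fun i => k i θ) (Finset.mem_univ j)).symm
  have hκle : ∀ j θ, ‖κ j θ‖ ≤ 2 ^ n := by
    intro j θ
    calc ‖κ j θ‖ ≤ ∏ i ∈ Finset.univ.erase j, (2 : ℝ) := by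
          rw [hκ, norm_prod]
          exact Finset.prod_le_prod (fun _ _ => norm_nonneg _)
            fun i _ => norm_kernel_le hr (hz i) θ i
      _ ≤ 2 ^ n := by
          rw [Finset.prod_const]
          refine pow_le_pow_right₀ (by norm_num) ?_
          exact (Finset.card_le_univ _).trans (by simp)
  set Y : (Fin n → UnitAddCircle) → En n := fun θ => z + s • (torusPt R θ - z) with hY
  have hζ := continuous_torusPt (n := n) R
  have hYc : Continuous Y := by fun_prop
  have hdu : Continuous fun θ => fderiv ℝ u (Y θ) :=
    (hu.continuous_fderiv (by norm_num)).comp hYc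
  set e : Fin n → En n := fun j => EuclideanSpace.single j (1 : ℂ) with he
  have hζj : ∀ j, Continuous fun θ : Fin n → UnitAddCircle => torusPt R θ j := fun j =>
    (PiLp.continuous_apply 2 _ j).comp hζ
  have hrot : ∀ j, ∫ θ, fderiv ℝ u (Y θ) ((Complex.I * torusPt R θ j) • e j) * κ j θ = 0 := by
    intro j
    have h := integral_fderiv_rotation_eq_zero R (v := fun x => u (z + s • (x - z)))
      (hu.comp (by fun_prop)) j (hκc j) (by
        intro θ t
        refine Finset.prod_congr rfl fun i hi => ?_
        simp only [hk, torusPt_apply]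
        simp [Finset.ne_of_mem_erase hi])
    have hd : ∀ x, fderiv ℝ (fun x => u (z + s • (x - z))) x = s • fderiv ℝ u (z + s • (x - z)) := by
      intro x
      have h1 : HasFDerivAt (fun x : En n => z + s • (x - z))
          (s • ContinuousLinearMap.id ℝ (En n)) x :=
        (((hasFDerivAt_id x).sub_const z).const_smul s).const_add z
      have h2 := ((hu.differentiable (by norm_num)) (z + s • (x - z))).hasFDerivAt.comp x h1
      refine h2.fderiv.trans ?_
      ext v; simp
    simp only [hd, _root_.smul_apply, smul_mul_assoc] at h
    rw [integral_smul, smul_eq_zero] at h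
    exact h.resolve_left hs
  have hint : ∀ {g : (Fin n → UnitAddCircle) → ℂ}, Continuous g → Integrable g := fun hg =>
    hg.integrable_of_hasCompactSupport (HasCompactSupport.of_compactSpace _)
  have hsplit : ∀ θ, fderiv ℝ u (Y θ) (torusPt R θ - z) * cauchyKer R z θ =
      ∑ j, fderiv ℝ u (Y θ) ((torusPt R θ j - z j) • e j) * (k j θ * κ j θ) := by
    intro θ
    have h1 : torusPt R θ - z = ∑ j, (torusPt R θ j - z j) • e j := by
      ext i
      simp [he, Finset.sum_apply, Pi.single_apply]
    conv_lhs => rw [h1, map_sum, Finset.sum_mul]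
    exact Finset.sum_congr rfl fun j _ => by rw [hKκ j]
  have hcont1 : ∀ j, Continuous fun θ =>
      fderiv ℝ u (Y θ) ((torusPt R θ j - z j) • e j) * (k j θ * κ j θ) := fun j =>
    (hdu.clm_apply (((hζj j).sub continuous_const).smul continuous_const)).mul
      ((hkc j).mul (hκc j))
  have hcont2 : ∀ j, Continuous fun θ =>
      fderiv ℝ u (Y θ) ((Complex.I * torusPt R θ j) • e j) * κ j θ := fun j =>
    (hdu.clm_apply ((continuous_const.mul (hζj j)).smul continuous_const)).mul (hκc j)
  change ‖∫ θ, fderiv ℝ u (Y θ) (torusPt R θ - z) * cauchyKer R z θ‖ ≤ _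
  simp only [hsplit]
  rw [integral_finsetSum _ fun j _ => hint (hcont1 j)]
  refine (norm_sum_le _ _).trans ?_
  have hj : ∀ j ∈ (Finset.univ : Finset (Fin n)), ‖∫ θ,
      fderiv ℝ u (Y θ) ((torusPt R θ j - z j) • e j) * (k j θ * κ j θ)‖ ≤ 8 * r * A * 2 ^ n := by
    intro j _
    have h1 : ∫ θ, fderiv ℝ u (Y θ) ((torusPt R θ j - z j) • e j) * (k j θ * κ j θ) =
        ∫ θ, (fderiv ℝ u (Y θ) ((torusPt R θ j - z j) • e j) * (k j θ * κ j θ) + Complex.I *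
          (fderiv ℝ u (Y θ) ((Complex.I * torusPt R θ j) • e j) * κ j θ)) := by
      rw [integral_add (hint (hcont1 j)) ((hint (hcont2 j)).const_mul _),
        MeasureTheory.integral_const_mul, hrot j, mul_zero, add_zero]
    rw [h1]
    suffices H : ∀ θ, ‖fderiv ℝ u (Y θ) ((torusPt R θ j - z j) • e j) * (k j θ * κ j θ) +
        Complex.I * (fderiv ℝ u (Y θ) ((Complex.I * torusPt R θ j) • e j) * κ j θ)‖ ≤
        8 * r * A * 2 ^ n by
      have : IsProbabilityMeasure (volume : Measure UnitAddCircle) := ⟨UnitAddCircle.measure_univ⟩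
      simpa using norm_integral_le_of_norm_le_const
        (μ := (volume : Measure (Fin n → UnitAddCircle))) (Filter.Eventually.of_forall H)
    intro θ
    have h2 : fderiv ℝ u (Y θ) ((torusPt R θ j - z j) • e j) * (k j θ * κ j θ) + Complex.I *
          (fderiv ℝ u (Y θ) ((Complex.I * torusPt R θ j) • e j) * κ j θ) =
        (fderiv ℝ u (Y θ) ((torusPt R θ j - z j) • e j) * k j θ + Complex.I *
          fderiv ℝ u (Y θ) ((Complex.I * torusPt R θ j) • e j)) * κ j θ := by ring
    rw [h2, norm_mul]
    have hnz : torusPt R θ j - z j ≠ 0 := torusPt_sub_ne_zero hR0 (hzR j)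
    have hnorm := norm_torusPt_apply hR0 θ j
    have h3 := norm_kernel_combination_le
      ((fderiv ℝ u (Y θ)).comp ((ContinuousLinearMap.toSpanSingleton ℂ (e j)).restrictScalars ℝ))
      (A := A) (r := r) (torusPt R θ j) (torusPt R θ j - z j) hnz
      (by simpa [he] using hA (Y θ) j) (norm_kernel_le hr (hz j) θ j) hnorm.le
      ((norm_sub_le _ _).trans (by rw [hnorm]; linarith [hz j]))
    simp only [ContinuousLinearMap.comp_apply, ContinuousLinearMap.coe_restrictScalars',
      ContinuousLinearMap.toSpanSingleton_apply] at h3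
    have h4 : 0 ≤ 8 * r * A := (norm_nonneg _).trans h3
    exact mul_le_mul h3 (hκle j θ) (norm_nonneg _) h4
  refine (Finset.sum_le_card_nsmul _ _ _ hj).trans ?_
  simp

/-- Cauchy's formula on a polydisc holds up to a bounded error for functions with bounded
`∂̄`-derivative. -/
theorem norm_sub_integral_cauchyKer_le {r A : ℝ} (hr : 0 < r) {z : En n} (hz : ∀ i, ‖z i‖ ≤ r)
    {u : En n → ℂ} (hu : ContDiff ℝ 1 u)
    (hA : ∀ x (j : Fin n), ‖fderiv ℝ u x (EuclideanSpace.single j 1) +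
      Complex.I * fderiv ℝ u x (Complex.I • EuclideanSpace.single j 1)‖ ≤ 2 * A) :
    ‖(∫ θ, u (torusPt (2 * r) θ) * cauchyKer (2 * r) z θ) - u z‖ ≤ n * (8 * r * A * 2 ^ n) := by
  have hR0 : 0 ≤ 2 * r := by positivity
  have hzR : ∀ i, ‖z i‖ < 2 * r := fun i => (hz i).trans_lt (by linarith)
  have hζ := continuous_torusPt (n := n) (2 * r)
  have hK : Continuous fun θ => cauchyKer (2 * r) z θ :=
    continuous_finsetProd _ fun i _ => continuous_kernel_apply hR0 (hzR i) i
  have hJ := hasDerivAt_integral_of_compact (μ := (volume : Measure (Fin n → UnitAddCircle)))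
    (F := fun s θ => u (z + s • (torusPt (2 * r) θ - z)) * cauchyKer (2 * r) z θ)
    (F' := fun s θ => fderiv ℝ u (z + s • (torusPt (2 * r) θ - z)) (torusPt (2 * r) θ - z) *
      cauchyKer (2 * r) z θ)
    (fun s => (hu.continuous.comp (by fun_prop)).mul hK)
    (by
      have h1 : Continuous fun q : ℝ × (Fin n → UnitAddCircle) =>
          fderiv ℝ u (z + q.1 • (torusPt (2 * r) q.2 - z)) :=
        (hu.continuous_fderiv (by norm_num)).comp (by fun_prop)
      exact (h1.clm_apply (by fun_prop)).mul (hK.comp continuous_snd))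
    (fun s θ => by
      have h1 : HasDerivAt (fun s : ℝ => z + s • (torusPt (2 * r) θ - z))
          (torusPt (2 * r) θ - z) s := by
        simpa using ((hasDerivAt_id s).smul_const (torusPt (2 * r) θ - z)).const_add z
      exact (((hu.differentiable (by norm_num)) _).hasFDerivAt.comp_hasDerivAt s h1).mul_const _)
  set J : ℝ → ℂ := fun s => ∫ θ, u (z + s • (torusPt (2 * r) θ - z)) * cauchyKer (2 * r) z θ
    with hJdef
  have hJ0 : J 0 = u z := by
    simp [hJdef, MeasureTheory.integral_const_mul, integral_cauchyKer hzR]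
  have hJ1 : J 1 = ∫ θ, u (torusPt (2 * r) θ) * cauchyKer (2 * r) z θ := by simp [hJdef]
  rw [← hJ0, ← hJ1]
  have hJc : Continuous J := continuous_iff_continuousAt.2 fun s => (hJ s).continuousAt
  have hle : ∀ s ∈ Ioo (0 : ℝ) 1, ‖J 1 - J s‖ ≤ n * (8 * r * A * 2 ^ n) := by
    intro s hs
    have h := norm_image_sub_le_of_norm_deriv_le_segment' (f := J) (a := s) (b := 1)
      (fun x _ => (hJ x).hasDerivWithinAt)
      (fun x hx => norm_deriv_cauchy_homotopy_le hr hz hu hA (hs.1.trans_le hx.1).ne') 1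
      (right_mem_Icc.2 hs.2.le)
    have h0 : 0 ≤ n * (8 * r * A * 2 ^ n) := (norm_nonneg _).trans
      (norm_deriv_cauchy_homotopy_le hr hz hu hA hs.1.ne')
    exact h.trans (mul_le_of_le_one_right h0 (by linarith [hs.1]))
  have hlim : Filter.Tendsto (fun s => ‖J 1 - J s‖) (𝓝[>] 0) (𝓝 ‖J 1 - J 0‖) :=
    ((continuous_const.sub hJc).norm.tendsto 0).mono_left nhdsWithin_le_nhds
  exact le_of_tendsto hlim (Filter.mem_of_superset (Ioo_mem_nhdsGT one_pos) hle)

end CauchyApprox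

section WeightApprox

variable {n : ℕ}

/-- The `(1,0)`-part of `dφ` at `x`, evaluated on `z`. -/
def dPart (φ : En n → ℝ) (z x : En n) : ℂ :=
  ((fderiv ℝ φ x z : ℂ) - Complex.I * (fderiv ℝ φ x (Complex.I • z) : ℂ)) / 2

theorem abs_levi_polarization_le {φ : En n → ℝ} (hφ : ContDiff ℝ 2 φ) {M : ℝ}
    (h0 : ∀ z v, 0 ≤ levi φ z v) (hM : ∀ z v, levi φ z v ≤ M * ‖v‖ ^ 2) (hM0 : 0 ≤ M)
    (x v z : En n) :
    |hess φ x v z + hess φ x (Complex.I • v) (Complex.I • z)| ≤ M * (‖v‖ + ‖z‖) ^ 2 := by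
  have hsym : ∀ a b, hess φ x a b = hess φ x b a := fun a b =>
    (hφ.contDiffAt.isSymmSndFDerivAt (by simp)) a b
  have hp := hM x (v + z)
  have hm := hM x (v - z)
  have hp0 := h0 x (v + z)
  have hm0 := h0 x (v - z)
  have hpn : ‖v + z‖ ^ 2 ≤ (‖v‖ + ‖z‖) ^ 2 := by gcongr; exact norm_add_le _ _
  have hmn : ‖v - z‖ ^ 2 ≤ (‖v‖ + ‖z‖) ^ 2 := by gcongr; exact norm_sub_le _ _
  have hp' := mul_le_mul_of_nonneg_left hpn hM0
  have hm' := mul_le_mul_of_nonneg_left hmn hM0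
  have key : hess φ x v z + hess φ x (Complex.I • v) (Complex.I • z) =
      levi φ x (v + z) - levi φ x (v - z) := by
    have e1 := hsym z v
    have e2 := hsym (Complex.I • z) (Complex.I • v)
    simp only [levi, hess, smul_add, smul_sub, map_add, map_sub, _root_.add_apply,
      _root_.sub_apply] at e1 e2 ⊢
    linarith
  rw [key, abs_le]
  constructor <;> linarith

theorem contDiff_dPart {φ : En n → ℝ} (hφ : ContDiff ℝ 2 φ) (z : En n) :
    ContDiff ℝ 1 (dPart φ z) := by
  have h : ContDiff ℝ 1 (fderiv ℝ φ) := hφ.fderiv_right (by norm_num)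
  have h1 : ∀ v : En n, ContDiff ℝ 1 fun x => ((fderiv ℝ φ x v : ℝ) : ℂ) := fun v =>
    Complex.ofRealCLM.contDiff.comp (h.clm_apply contDiff_const)
  exact ((h1 z).sub (contDiff_const.mul (h1 _))).div_const 2

theorem fderiv_dPart {φ : En n → ℝ} (hφ : ContDiff ℝ 2 φ) (z x v : En n) :
    fderiv ℝ (dPart φ z) x v =
      ((hess φ x v z : ℂ) - Complex.I * (hess φ x v (Complex.I • z) : ℂ)) / 2 := by
  have h : Differentiable ℝ (fderiv ℝ φ) :=
    (hφ.fderiv_right (m := 1) (by norm_num)).differentiable (by norm_num)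
  have h1 : ∀ y : En n, HasFDerivAt (fun x => ((fderiv ℝ φ x y : ℝ) : ℂ))
      (Complex.ofRealCLM.comp ((fderiv ℝ (fderiv ℝ φ) x).flip y)) x := by
    intro y
    have h2 : HasFDerivAt (fun x => fderiv ℝ φ x y) ((fderiv ℝ (fderiv ℝ φ) x).flip y) x := by
      simpa using (h x).hasFDerivAt.clm_apply (hasFDerivAt_const y x)
    exact Complex.ofRealCLM.hasFDerivAt.comp x h2
  have h3 := ((h1 z).sub ((h1 (Complex.I • z)).const_mul Complex.I)).mul_const ((2 : ℂ)⁻¹)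
  have h4 : fderiv ℝ (dPart φ z) x = _ := h3.fderiv
  rw [h4]
  simp [hess]
  ring

theorem norm_dbar_dPart_le {φ : En n → ℝ} (hφ : ContDiff ℝ 2 φ) {M r : ℝ}
    (h0 : ∀ z v, 0 ≤ levi φ z v) (hM : ∀ z v, levi φ z v ≤ M * ‖v‖ ^ 2) (hM0 : 0 ≤ M)
    {z : En n} (hz : ‖z‖ ≤ r) (x : En n) (j : Fin n) :
    ‖fderiv ℝ (dPart φ z) x (EuclideanSpace.single j 1) +
      Complex.I * fderiv ℝ (dPart φ z) x (Complex.I • EuclideanSpace.single j 1)‖ ≤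
      2 * (M * (1 + r) ^ 2 / 2) := by
  set v : En n := EuclideanSpace.single j 1 with hv
  have hv1 : ‖v‖ = 1 := by simp [hv]
  have hb : ∀ y : En n, ‖y‖ = 1 →
      ‖((hess φ x y z + hess φ x (Complex.I • y) (Complex.I • z) : ℝ) : ℂ)‖ ≤ M * (1 + r) ^ 2 := by
    intro y hy
    rw [Complex.norm_real, Real.norm_eq_abs]
    refine (abs_levi_polarization_le hφ h0 hM hM0 x y z).trans ?_
    rw [hy]
    gcongr
  have hIv : ‖Complex.I • v‖ = 1 := by rw [norm_smul, hv1]; simp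
  have key : fderiv ℝ (dPart φ z) x v + Complex.I * fderiv ℝ (dPart φ z) x (Complex.I • v) =
      (((hess φ x v z + hess φ x (Complex.I • v) (Complex.I • z) : ℝ) : ℂ) + Complex.I *
        ((hess φ x (Complex.I • v) z +
          hess φ x (Complex.I • Complex.I • v) (Complex.I • z) : ℝ) : ℂ)) / 2 := by
    have h2 : hess φ x (Complex.I • Complex.I • v) (Complex.I • z) =
        - hess φ x v (Complex.I • z) := by
      rw [smul_smul, Complex.I_mul_I, neg_one_smul]; simp [hess]
    rw [fderiv_dPart hφ, fderiv_dPart hφ, h2]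
    push_cast
    linear_combination (-(hess φ x (Complex.I • v) (Complex.I • z) : ℂ) / 2) * Complex.I_sq
  rw [key, norm_div]
  have h3 := norm_add_le ((hess φ x v z + hess φ x (Complex.I • v) (Complex.I • z) : ℝ) : ℂ)
    (Complex.I * ((hess φ x (Complex.I • v) z +
          hess φ x (Complex.I • Complex.I • v) (Complex.I • z) : ℝ) : ℂ))
  have h4 := hb v hv1
  have h5 := hb _ hIv
  rw [norm_mul, Complex.norm_I, one_mul] at h3
  rw [Complex.norm_two, div_le_iff₀ two_pos]
  linarith

/-- `dPart` is complex linear in the direction. -/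
theorem dPart_eq_sum (φ : En n → ℝ) (z x : En n) :
    dPart φ z x = ∑ i, dPart φ (EuclideanSpace.single i 1) x * z i := by
  let ℓ : En n →ₗ[ℂ] ℂ :=
    { toFun := fun z => dPart φ z x
      map_add' := fun a b => by simp only [dPart, smul_add, map_add]; push_cast; ring
      map_smul' := fun c a => by
        have h : ∀ b : En n, fderiv ℝ φ x (c • b) =
            c.re * fderiv ℝ φ x b + c.im * fderiv ℝ φ x (Complex.I • b) := by
          intro b
          conv_lhs => rw [← Complex.re_add_im c]
          rw [add_smul, map_add, mul_smul, Complex.coe_smul, Complex.coe_smul, map_smul, map_smul]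
          rfl
        simp only [dPart, RingHom.id_apply, smul_eq_mul]
        rw [smul_comm Complex.I c a, h, h, smul_smul, Complex.I_mul_I, neg_one_smul, map_neg]
        conv_rhs => rw [← Complex.re_add_im c]
        push_cast
        linear_combination (c.im * (fderiv ℝ φ x (Complex.I • a) : ℂ) / 2) * Complex.I_sq }
  have hz : z = ∑ i, z i • (EuclideanSpace.single i 1 : En n) := by
    ext i
    simp [Finset.sum_apply, Pi.single_apply]
  have h1 : dPart φ z x = ℓ z := rfl
  rw [h1]
  conv_lhs => rw [hz, map_sum]
  exact Finset.sum_congr rfl fun i _ => by rw [map_smul, smul_eq_mul, mul_comm]; rfl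

/-- Parameters of the iterated integral: a segment times the torus. -/
abbrev CauchyParam (n : ℕ) : Type := unitInterval × (Fin n → UnitAddCircle)

theorem exists_differentiableOn_integral_cauchyKer {R : ℝ} (hR : 0 < R)
    {L : Fin n → En n → ℂ} (hL : ∀ i, Continuous (L i)) :
    DifferentiableOn ℂ (fun z => ∫ q : CauchyParam n,
      (∑ i, L i (torusPt R q.2) * z i) * cauchyKer R ((q.1 : ℂ) • z) q.2) (ball (0 : En n) R) := by
  have hζ := continuous_torusPt (n := n) R
  have hζj : ∀ j, Continuous fun θ : Fin n → UnitAddCircle => torusPt R θ j := fun j =>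
    (PiLp.continuous_apply 2 _ j).comp hζ
  have hne : ∀ z ∈ ball (0 : En n) R, ∀ (q : CauchyParam n) j,
      torusPt R q.2 j - (q.1 : ℂ) * z j ≠ 0 := by
    intro z hz q j
    refine torusPt_sub_ne_zero hR.le ?_
    rw [mem_ball_zero_iff] at hz
    rw [norm_mul, Complex.norm_real, Real.norm_of_nonneg q.1.2.1]
    exact (mul_le_of_le_one_left (norm_nonneg _) q.1.2.2).trans_lt
      ((PiLp.norm_apply_le z j).trans_lt hz)
  set pr : Fin n → En n →L[ℂ] ℂ := fun j => EuclideanSpace.proj j with hpr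
  set k : Fin n → En n → CauchyParam n → ℂ := fun j z q =>
    torusPt R q.2 j / (torusPt R q.2 j - (q.1 : ℂ) * z j) with hk
  set k' : Fin n → En n → CauchyParam n → En n →L[ℂ] ℂ := fun j z q =>
    (torusPt R q.2 j * (q.1 : ℂ) / (torusPt R q.2 j - (q.1 : ℂ) * z j) ^ 2) • pr j with hk'
  set F' : En n → CauchyParam n → En n →L[ℂ] ℂ := fun z q =>
    (∑ i, L i (torusPt R q.2) * z i) •
      (∑ i, (∏ j ∈ Finset.univ.erase i, k j z q) • k' i z q) +
    (∏ j, k j z q) • (∑ i, L i (torusPt R q.2) • pr i) with hF'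
  have hden : ∀ j, Continuous fun x : En n × CauchyParam n => torusPt R x.2.2 j - (x.2.1 : ℂ) * x.1 j := by
    intro j
    have h1 := hζj j
    have h2 : Continuous fun x : En n × CauchyParam n => ((x.2.1 : ℝ) : ℂ) := by fun_prop
    have h3 : Continuous fun x : En n × CauchyParam n => x.1 j :=
      (PiLp.continuous_apply 2 _ j).comp continuous_fst
    exact (h1.comp (by fun_prop : Continuous fun x : En n × CauchyParam n => x.2.2)).sub (h2.mul h3)
  have hnum : ∀ j, Continuous fun x : En n × CauchyParam n => torusPt R x.2.2 j := fun j =>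
    (hζj j).comp (by fun_prop : Continuous fun x : En n × CauchyParam n => x.2.2)
  have hLc : ∀ i, Continuous fun x : En n × CauchyParam n => L i (torusPt R x.2.2) := fun i =>
    (hL i).comp (hζ.comp (by fun_prop : Continuous fun x : En n × CauchyParam n => x.2.2))
  have hkc : ∀ j, ContinuousOn (fun x : En n × CauchyParam n => k j x.1 x.2) (ball 0 R ×ˢ univ) := fun j =>
    (hnum j).continuousOn.div (hden j).continuousOn fun x hx => hne x.1 hx.1 x.2 j
  have hk'c : ∀ j, ContinuousOn (fun x : En n × CauchyParam n => k' j x.1 x.2) (ball 0 R ×ˢ univ) := fun j =>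
    ContinuousOn.smul (((hnum j).mul (by fun_prop)).continuousOn.div
      ((hden j).pow 2).continuousOn fun x hx => pow_ne_zero 2 (hne x.1 hx.1 x.2 j))
      continuousOn_const
  have hSc : Continuous fun x : En n × CauchyParam n => ∑ i, L i (torusPt R x.2.2) * x.1 i :=
    continuous_finsetSum _ fun i _ => (hLc i).mul
      ((PiLp.continuous_apply 2 _ i).comp continuous_fst)
  have hF'c : ContinuousOn (Function.uncurry F') (ball 0 R ×ˢ univ) := by
    have h1 : ∀ s : Finset (Fin n), ContinuousOn (fun x : En n × CauchyParam n =>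
        ∏ j ∈ s, k j x.1 x.2) (ball 0 R ×ˢ univ) := fun s =>
      continuousOn_finsetProd _ fun j _ => hkc j
    have h2 : ContinuousOn (fun x : En n × CauchyParam n =>
        ∑ i, (∏ j ∈ Finset.univ.erase i, k j x.1 x.2) • k' i x.1 x.2) (ball 0 R ×ˢ univ) :=
      continuousOn_finsetSum _ fun i _ => (h1 _).smul (hk'c i)
    have h3 : ContinuousOn (fun x : En n × CauchyParam n =>
        ∑ i, L i (torusPt R x.2.2) • pr i) (ball 0 R ×ˢ univ) :=
      continuousOn_finsetSum _ fun i _ => (hLc i).continuousOn.smul continuousOn_const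
    exact (hSc.continuousOn.smul h2).add ((h1 _).smul h3)
  have hkd : ∀ z ∈ ball (0 : En n) R, ∀ (q : CauchyParam n) j, HasFDerivAt (fun z => k j z q) (k' j z q) z := by
    intro z hz q j
    have h1 : HasFDerivAt (fun z : En n => z j) (pr j) z := (pr j).hasFDerivAt
    have h2 := ((h1.const_mul (q.1 : ℂ)).const_sub (torusPt R q.2 j))
    have h3 := (hasDerivAt_inv (hne z hz q j)).comp_hasFDerivAt z h2
    have h4 := h3.const_mul (torusPt R q.2 j)
    refine (h4.congr_fderiv ?_)
    ext v
    simp [hk']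
    ring
  intro z hz
  refine (HasFDerivAt.differentiableAt (hasFDerivAt_integral_of_compact
    (μ := (volume : Measure (CauchyParam n))) (F' := F') isOpen_ball ?_ hF'c ?_ hz)).differentiableWithinAt
  · intro x hx
    have h1 : Continuous fun q : CauchyParam n => (x, q) := by fun_prop
    have h2 : Continuous fun q : CauchyParam n => ∏ j, k j x q := continuous_finsetProd _ fun j _ =>
      (hkc j).comp_continuous h1 fun q => ⟨hx, mem_univ _⟩
    exact (hSc.comp h1).mul h2
  · intro x hx q
    have h1 : HasFDerivAt (fun z : En n => ∑ i, L i (torusPt R q.2) * z i)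
        (∑ i, L i (torusPt R q.2) • pr i) x :=
      HasFDerivAt.fun_sum fun i _ => (pr i).hasFDerivAt.const_mul _
    have h2 := HasFDerivAt.finsetProd (u := Finset.univ) (x := x)
      (fun j _ => hkd x hx q j)
    exact h1.mul h2

/-- A `C²` function with bounded complex Hessian is the real part of a holomorphic function up to
a bounded error, on balls centred at the origin. -/
theorem exists_differentiableOn_abs_sub_re_le_zero {M r : ℝ} (hr : 0 < r) (hM0 : 0 ≤ M)
    {φ : En n → ℝ} (hφ : ContDiff ℝ 2 φ) (h0 : ∀ z v, 0 ≤ levi φ z v)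
    (hM : ∀ z v, levi φ z v ≤ M * ‖v‖ ^ 2) :
    ∃ g : En n → ℂ, DifferentiableOn ℂ g (ball 0 r) ∧ ∀ z ∈ ball (0 : En n) r,
      |φ z - (g z).re| ≤ 2 * (n * (8 * r * (M * (1 + r) ^ 2 / 2) * 2 ^ n)) := by
  have hR : 0 < 2 * r := by positivity
  set L : Fin n → En n → ℂ := fun i => dPart φ (EuclideanSpace.single i 1) with hLdef
  have hL : ∀ i, Continuous (L i) := fun i => (contDiff_dPart hφ _).continuous
  have hG := exists_differentiableOn_integral_cauchyKer hR hL
  set G : En n → ℂ := fun z => ∫ q : CauchyParam n,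
      (∑ i, L i (torusPt (2 * r) q.2) * z i) * cauchyKer (2 * r) ((q.1 : ℂ) • z) q.2 with hGdef
  refine ⟨fun z => φ 0 + 2 * G z,
    ((hG.mono (ball_subset_ball (by linarith))).const_mul 2).const_add _, fun z hz => ?_⟩
  rw [mem_ball_zero_iff] at hz
  have htz : ∀ (t : unitInterval) i, ‖((t : ℂ) • z) i‖ ≤ r := by
    intro t i
    refine (PiLp.norm_apply_le _ i).trans ?_
    rw [norm_smul, Complex.norm_real, Real.norm_of_nonneg t.2.1]
    exact (mul_le_of_le_one_left (norm_nonneg _) t.2.2).trans hz.le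
  have hζ := continuous_torusPt (n := n) (2 * r)
  have hUc : Continuous (dPart φ z) := (contDiff_dPart hφ z).continuous
  have hKc : Continuous fun q : CauchyParam n =>
      cauchyKer (2 * r) ((q.1 : ℂ) • z) q.2 := by
    refine continuous_finsetProd _ fun j _ => Continuous.div ?_ ?_ ?_
    · exact (PiLp.continuous_apply 2 _ j).comp (hζ.comp continuous_snd)
    · refine ((PiLp.continuous_apply 2 _ j).comp (hζ.comp continuous_snd)).sub
        ((PiLp.continuous_apply 2 _ j).comp ?_)
      fun_prop
    · exact fun q => torusPt_sub_ne_zero hR.le ((htz q.1 j).trans_lt (by linarith))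
  have hGz : G z = ∫ t : unitInterval, ∫ θ,
      dPart φ z (torusPt (2 * r) θ) * cauchyKer (2 * r) ((t : ℂ) • z) θ := by
    simp only [hGdef, hLdef, ← dPart_eq_sum]
    refine integral_prod (fun q : CauchyParam n =>
      dPart φ z (torusPt (2 * r) q.2) * cauchyKer (2 * r) ((q.1 : ℂ) • z) q.2)
      (Continuous.integrable_of_hasCompactSupport ?_ (HasCompactSupport.of_compactSpace _))
    exact (hUc.comp (hζ.comp continuous_snd)).mul hKc
  have hinner : Continuous fun t : unitInterval => ∫ θ,
      dPart φ z (torusPt (2 * r) θ) * cauchyKer (2 * r) ((t : ℂ) • z) θ := by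
    refine continuous_parametric_integral_of_continuous
      (μ := (volume : Measure (Fin n → UnitAddCircle))) (s := univ)
      (f := fun (t : unitInterval) (θ : Fin n → UnitAddCircle) =>
        dPart φ z (torusPt (2 * r) θ) * cauchyKer (2 * r) ((t : ℂ) • z) θ) ?_ isCompact_univ |>.congr ?_
    · exact (hUc.comp (hζ.comp continuous_snd)).mul hKc
    · intro t; rw [Measure.restrict_univ]
  have hline : Continuous fun t : unitInterval => dPart φ z ((t : ℂ) • z) :=
    hUc.comp (by fun_prop)
  have hint : ∀ {g : unitInterval → ℂ}, Continuous g → Integrable g := fun hg =>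
    hg.integrable_of_hasCompactSupport (HasCompactSupport.of_compactSpace _)
  have hbound : ‖G z - ∫ t : unitInterval, dPart φ z ((t : ℂ) • z)‖ ≤
      n * (8 * r * (M * (1 + r) ^ 2 / 2) * 2 ^ n) := by
    rw [hGz, ← integral_sub (hint hinner) (hint hline)]
    have H : ∀ t : unitInterval, ‖(∫ θ, dPart φ z (torusPt (2 * r) θ) *
        cauchyKer (2 * r) ((t : ℂ) • z) θ) - dPart φ z ((t : ℂ) • z)‖ ≤
        n * (8 * r * (M * (1 + r) ^ 2 / 2) * 2 ^ n) := fun t =>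
      norm_sub_integral_cauchyKer_le hr (htz t) (contDiff_dPart hφ z)
        (norm_dbar_dPart_le hφ h0 hM hM0 hz.le)
    simpa using norm_integral_le_of_norm_le_const
      (μ := (volume : Measure unitInterval)) (Filter.Eventually.of_forall H)
  have hftc : φ z - φ 0 = 2 * (∫ t : unitInterval, dPart φ z ((t : ℂ) • z)).re := by
    have hd : ∀ t : ℝ, HasDerivAt (fun t : ℝ => φ (t • z)) (fderiv ℝ φ (t • z) z) t := by
      intro t
      have h1 : HasDerivAt (fun t : ℝ => t • z) z t := by
        simpa using (hasDerivAt_id t).smul_const z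
      exact ((hφ.differentiable (by norm_num)) _).hasFDerivAt.comp_hasDerivAt t h1
    have hc : Continuous fun t : ℝ => fderiv ℝ φ (t • z) z :=
      ((hφ.continuous_fderiv (by norm_num)).comp (by fun_prop)).clm_apply continuous_const
    have h1 := intervalIntegral.integral_eq_sub_of_hasDerivAt (a := 0) (b := 1)
      (fun t _ => hd t) (hc.intervalIntegrable _ _)
    simp only [one_smul, zero_smul] at h1
    have h2 : (∫ t : unitInterval, dPart φ z ((t : ℂ) • z)).re =
        ∫ t : unitInterval, (dPart φ z ((t : ℂ) • z)).re :=
      (integral_re (hint hline)).symm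
    have h3 : ∀ t : unitInterval, (dPart φ z ((t : ℂ) • z)).re =
        fderiv ℝ φ ((t : ℝ) • z) z / 2 := by
      intro t
      rw [Complex.coe_smul]
      simp [dPart]
    rw [h2, ← h1]
    simp only [h3]
    rw [intervalIntegral.integral_of_le zero_le_one, ← integral_Icc_eq_integral_Ioc,
      integral_div, ← integral_subtype measurableSet_Icc (fun t : ℝ => fderiv ℝ φ (t • z) z)]
    ring
  have hfin : φ z - ((φ 0 : ℂ) + 2 * G z).re =
      -2 * (G z - ∫ t : unitInterval, dPart φ z ((t : ℂ) • z)).re := by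
    have h1 : ((φ 0 : ℂ) + 2 * G z).re = φ 0 + 2 * (G z).re := by simp
    rw [h1, Complex.sub_re]
    linarith
  rw [hfin, abs_mul]
  have := (Complex.abs_re_le_norm _).trans hbound
  rw [abs_neg, abs_two]
  linarith

/-- A `C²` function with bounded complex Hessian is the real part of a holomorphic function up to
a uniformly bounded error, on balls of fixed radius. -/
theorem exists_differentiableOn_abs_sub_re_le (n : ℕ) {M r : ℝ} (hr : 0 < r) (hM0 : 0 ≤ M) :
    ∃ C : ℝ, 0 ≤ C ∧ ∀ φ : En n → ℝ, ContDiff ℝ 2 φ → (∀ z v, 0 ≤ levi φ z v) →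
      (∀ z v, levi φ z v ≤ M * ‖v‖ ^ 2) → ∀ w, ∃ g : En n → ℂ, DifferentiableOn ℂ g (ball w r) ∧
        ∀ z ∈ ball w r, |φ z - (g z).re| ≤ C := by
  refine ⟨2 * (n * (8 * r * (M * (1 + r) ^ 2 / 2) * 2 ^ n)), by positivity,
    fun φ hφ h0 hM w => ?_⟩
  have hh : ∀ x u v, hess (fun y => φ (y + w)) x u v = hess φ (x + w) u v := by
    intro x u v
    have h1 : fderiv ℝ (fun y => φ (y + w)) = fun y => fderiv ℝ φ (y + w) := by
      funext y; exact fderiv_comp_add_right w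
    rw [hess, h1, fderiv_comp_add_right, hess]
  obtain ⟨g, hg, hgb⟩ := exists_differentiableOn_abs_sub_re_le_zero (φ := fun y => φ (y + w)) hr hM0
    (hφ.comp (by fun_prop)) (fun z v => by simpa only [levi, hh] using h0 (z + w) v)
    (fun z v => by simpa only [levi, hh] using hM (z + w) v)
  have hmem : ∀ z ∈ ball w r, z - w ∈ ball (0 : En n) r := fun z hz => by
    rwa [mem_ball_zero_iff, ← dist_eq_norm]
  refine ⟨fun z => g (z - w), hg.comp (by fun_prop) hmem, fun z hz => ?_⟩
  simpa using hgb _ (hmem z hz)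

end WeightApprox

section NearestPointRay

variable {E : Type*} [NormedAddCommGroup E] [InnerProductSpace ℝ E]

open scoped InnerProductSpace in
/-- In a tube with continuous unique nearest-point projection, a normal segment can be doubled
in length without losing minimality. -/
theorem infDist_normal_segment_extend [ProperSpace E] {W : Set E} {pr : E → E} {ε₀ : ℝ}
    (hprc : ContinuousOn pr {z | infDist z W < ε₀})
    (hpr : ∀ z, infDist z W < ε₀ → pr z ∈ W ∧ dist z (pr z) = infDist z W ∧
      ∀ w ∈ W, dist z w = infDist z W → w = pr z)
    {w ν : E} (hw : w ∈ W) (hν : ‖ν‖ = 1) {s τ : ℝ} (hs : 0 < s) (hτ : 0 < τ) (hτs : τ ≤ s)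
    (hsτ : s + τ < ε₀) (hx : infDist (w + s • ν) W = s) :
    infDist (w + (s + τ) • ν) W = s + τ := by
  set x := w + s • ν with hxdef
  obtain ⟨z, hz, hmax⟩ := (isCompact_closedBall x τ).exists_isMaxOn
    ⟨x, mem_closedBall_self hτ.le⟩ (continuous_infDist_pt W).continuousOn
  have hzx : ‖z - x‖ ≤ τ := by rwa [← dist_eq_norm]
  have hds : s ≤ infDist z W := hx ▸ hmax (mem_closedBall_self hτ.le)
  have hlt : ∀ y ∈ closedBall x τ, infDist y W < ε₀ := by
    intro y hy
    have := infDist_le_infDist_add_dist (s := W) (x := y) (y := x)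
    rw [mem_closedBall] at hy
    linarith
  have hzlt := hlt z hz
  obtain ⟨hbW, hbd, -⟩ := hpr z hzlt
  set b := pr z with hb
  set d := infDist z W with hd
  have hd0 : 0 < d := hs.trans_le hds
  have hzb : ‖z - b‖ = d := by rw [← dist_eq_norm]; exact hbd
  set v := (τ / d) • (z - b) - (z - x) with hv
  -- first variation: the maximum point must be reached by moving straight away from `b`
  have hv0 : v = 0 := by
    by_contra hvne
    have hinner : 0 < ⟪v, z - b⟫_ℝ := by
      by_contra hle
      push Not at hle
      rw [hv, inner_sub_left, real_inner_smul_left, real_inner_self_eq_norm_sq, hzb] at hle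
      have e1 : τ / d * d ^ 2 = τ * d := by field_simp
      rw [e1] at hle
      have e2 : ‖v‖ ^ 2 ≤ 0 := by
        rw [hv, @norm_sub_sq ℝ, real_inner_smul_left, norm_smul, hzb, Real.norm_of_nonneg
          (by positivity), div_mul_cancel₀ _ hd0.ne', real_inner_comm]
        have e3 : ‖z - x‖ ^ 2 ≤ τ ^ 2 := by gcongr
        have e4 : τ * τ ≤ τ / d * ⟪z - x, z - b⟫_ℝ := by
          rw [div_mul_eq_mul_div, le_div_iff₀ hd0]
          nlinarith
        simp only [RCLike.re_to_real] at *
        nlinarith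
      exact hvne (norm_eq_zero.1 (by nlinarith [norm_nonneg v]))
    have hmem : ∀ h ∈ Icc (0 : ℝ) 1, z + h • v ∈ closedBall x τ := by
      intro h hh
      rw [mem_closedBall, dist_eq_norm]
      have e1 : z + h • v - x = (1 - h) • (z - x) + h • ((τ / d) • (z - b)) := by
        rw [hv]; module
      rw [e1]
      refine (norm_add_le _ _).trans ?_
      rw [norm_smul, norm_smul, norm_smul, hzb, Real.norm_of_nonneg (by linarith [hh.2]),
        Real.norm_of_nonneg hh.1, Real.norm_of_nonneg (by positivity), div_mul_cancel₀ _ hd0.ne']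
      nlinarith [hh.1, hh.2]
    have hcont : Filter.Tendsto (fun h : ℝ => ⟪v, z - pr (z + h • v)⟫_ℝ) (𝓝[>] 0)
        (𝓝 ⟪v, z - b⟫_ℝ) := by
      have h1 : Filter.Tendsto (fun h : ℝ => z + h • v) (𝓝[>] 0)
          (𝓝[{z | infDist z W < ε₀}] z) := by
        refine tendsto_nhdsWithin_iff.2 ⟨?_, ?_⟩
        · have : Continuous fun h : ℝ => z + h • v := by fun_prop
          simpa using (this.tendsto 0).mono_left nhdsWithin_le_nhds
        · filter_upwards [Ioo_mem_nhdsGT (zero_lt_one' ℝ)] with h hh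
          exact hlt _ (hmem h ⟨hh.1.le, hh.2.le⟩)
      exact tendsto_const_nhds.inner (tendsto_const_nhds.sub ((hprc z hzlt).tendsto.comp h1))
    obtain ⟨h, hpos, hh⟩ := ((hcont.eventually (lt_mem_nhds hinner)).and
      (Ioo_mem_nhdsGT (zero_lt_one' ℝ))).exists
    have hm := hmem h ⟨hh.1.le, hh.2.le⟩
    obtain ⟨hcW, hcd, -⟩ := hpr _ (hlt _ hm)
    set c := pr (z + h • v)
    have h1 : d ≤ ‖z - c‖ := by rw [← dist_eq_norm]; exact infDist_le_dist_of_mem hcW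
    have h2 : infDist (z + h • v) W ≤ d := hmax hm
    rw [← hcd, dist_eq_norm] at h2
    have e1 : z + h • v - c = (z - c) + h • v := by abel
    have e2 : ‖(z - c) + h • v‖ ^ 2 ≤ d ^ 2 := by rw [← e1]; gcongr
    rw [@norm_add_sq ℝ, real_inner_smul_right, real_inner_comm] at e2
    simp only [RCLike.re_to_real] at e2
    have e3 : d ^ 2 ≤ ‖z - c‖ ^ 2 := by gcongr
    have e4 := mul_pos hh.1 hpos
    nlinarith [sq_nonneg ‖h • v‖]
  have hzx' : z - x = (τ / d) • (z - b) := (sub_eq_zero.1 hv0).symm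
  have hτd : τ ≤ d := hτs.trans hds
  have hxb : x - b = (1 - τ / d) • (z - b) := by
    have : x - b = (z - b) - (z - x) := by abel
    rw [this, hzx', sub_smul, one_smul]
  have hnxb : dist x b = d - τ := by
    rw [dist_eq_norm, hxb, norm_smul, hzb, Real.norm_of_nonneg
      (sub_nonneg.2 ((div_le_one hd0).2 hτd)), sub_mul, one_mul, div_mul_cancel₀ _ hd0.ne']
  have h3 : d ≤ s + τ := by
    have := infDist_le_infDist_add_dist (s := W) (x := z) (y := x)
    rw [dist_eq_norm] at this
    linarith
  have h4 : infDist x W ≤ d - τ := hnxb ▸ infDist_le_dist_of_mem hbW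
  have hdeq : d = s + τ := by linarith
  have hxlt : infDist x W < ε₀ := hlt x (mem_closedBall_self hτ.le)
  have hbx : b = pr x := (hpr x hxlt).2.2 b hbW (by rw [hnxb, hx, hdeq]; ring)
  have hwx : w = pr x := (hpr x hxlt).2.2 w hw (by
    rw [hx, dist_eq_norm, hxdef, add_sub_cancel_left, norm_smul, hν, mul_one,
      Real.norm_of_nonneg hs.le])
  have hbw : b = w := hbx.trans hwx.symm
  have h5 : s • ν = (s / d) • (z - w) := by
    have e1 : x - w = s • ν := by rw [hxdef]; abel
    rw [← e1, ← hbw, hxb]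
    congr 1
    rw [hdeq]; field_simp; ring
  have h6 : z = w + (s + τ) • ν := by
    have e1 : z - w = (s + τ) • ν := by
      have : (s + τ) • ν = (d / s) • (s • ν) := by
        rw [smul_smul, div_mul_cancel₀ _ hs.ne', hdeq]
      rw [this, h5, smul_smul, div_mul_div_comm, mul_comm, div_self (by positivity), one_smul]
    rw [← e1]; abel
  rw [← h6, ← hdeq]

/-- In a tube with continuous unique nearest-point projection, minimality of a normal segment
persists up to the radius of the tube. -/
theorem infDist_normal_ray [ProperSpace E] {W : Set E} {pr : E → E} {ε₀ : ℝ}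
    (hprc : ContinuousOn pr {z | infDist z W < ε₀})
    (hpr : ∀ z, infDist z W < ε₀ → pr z ∈ W ∧ dist z (pr z) = infDist z W ∧
      ∀ w ∈ W, dist z w = infDist z W → w = pr z)
    {w ν : E} (hw : w ∈ W) (hν : ‖ν‖ = 1) {s r : ℝ} (hs : 0 < s)
    (hx : infDist (w + s • ν) W = s) (hsr : s ≤ r) (hr : r < ε₀) :
    infDist (w + r • ν) W = r := by
  have key : ∀ k : ℕ, infDist (w + min (2 ^ k * s) r • ν) W = min (2 ^ k * s) r := by
    intro k
    induction k with
    | zero => simpa [min_eq_left hsr] using hx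
    | succ k ih =>
      rcases le_or_gt r (2 ^ k * s) with h | h
      · rw [min_eq_right h] at ih
        rwa [min_eq_right (h.trans (by rw [pow_succ]; nlinarith [pow_pos (two_pos (α := ℝ)) k]))]
      · rw [min_eq_left h.le] at ih
        have hpos : 0 < 2 ^ k * s := by positivity
        set m := min (2 ^ (k + 1) * s) r with hm
        have h1 : m ≤ 2 * (2 ^ k * s) := by
          rw [hm, pow_succ]; exact (min_le_left _ _).trans (by linarith)
        have h2 : 2 ^ k * s < m := by
          rw [hm, lt_min_iff]; exact ⟨by rw [pow_succ]; linarith, h⟩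
        have h3 : m ≤ r := min_le_right _ _
        have := infDist_normal_segment_extend hprc hpr hw hν hpos (τ := m - 2 ^ k * s)
          (by linarith) (by linarith) (by linarith) ih
        simpa using this
  obtain ⟨k, hk⟩ := pow_unbounded_of_one_lt (r / s) (one_lt_two)
  have := key k
  rwa [min_eq_right ((div_le_iff₀ hs).1 hk.le)] at this

end NearestPointRay

section QuadraticContact

variable {n : ℕ}

/-- Second order Taylor estimate for entire functions. -/
theorem exists_norm_sub_fderiv_le {T : En n → ℂ} (hT : Differentiable ℂ T) (w : En n) :
    ∃ K > 0, ∀ b ∈ ball w 1, ‖T b - T w - fderiv ℂ T w (b - w)‖ ≤ K * ‖b - w‖ ^ 2 := by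
  set S : En n → ℂ := fun b => T b - fderiv ℂ T w (b - w) with hS
  have hSd : Differentiable ℂ S := hT.sub (by fun_prop)
  obtain ⟨K, hK⟩ := (isCompact_closedBall w 1).exists_bound_of_continuousOn
    (f := fun b => S b - S w) (hSd.continuous.sub continuous_const).continuousOn
  refine ⟨max K 1, by positivity, fun b hb => ?_⟩
  have h := Complex.dist_le_mul_div_pow_of_mapsTo_ball_of_isLittleO (n := 1) (f := S) (c := w)
    (R₁ := 1) (R₂ := max K 1) hSd.differentiableOn (fun x hx => by
      rw [mem_closedBall, dist_eq_norm]
      exact (hK x (ball_subset_closedBall hx)).trans (le_max_left _ _)) (by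
      have := (hT w).hasFDerivAt.isLittleO
      refine (this.norm_right).congr (fun x => ?_) (fun x => ?_)
      · simp [hS]; ring
      · simp) hb
  rw [dist_eq_norm, dist_eq_norm] at h
  have e : T b - T w - fderiv ℂ T w (b - w) = S b - S w := by simp [hS]; ring
  rw [e]
  simpa only [div_one, one_add_one_eq_two] using h

open scoped InnerProductSpace in
/-- A uniformly flat hypersurface lies between two tangent paraboloids at each of its points. -/
theorem exists_unit_normal_quadratic_contact {T : En n → ℂ} {W : Set (En n)} {ε₀ r : ℝ}
    (hT : Differentiable ℂ T) (hW : W = T ⁻¹' {0}) (hflat : UniformlyFlatWith ε₀ W)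
    {w : En n} (hw : w ∈ W) (hdT : fderiv ℂ T w ≠ 0) (hr0 : 0 < r) (hr : r < ε₀) :
    ∃ ν : En n, ‖ν‖ = 1 ∧ (∃ c : ℂ, c ≠ 0 ∧ ∀ v, fderiv ℂ T w v = c * ⟪ν, v⟫_ℂ) ∧
      ∀ x ∈ W, 2 * r * ‖⟪ν, x - w⟫_ℂ‖ ≤ ‖x - w‖ ^ 2 := by
  obtain ⟨-, pr, hprc, hpr⟩ := hflat
  set a : En n := (InnerProductSpace.toDual ℂ (En n)).symm (fderiv ℂ T w) with ha
  have hav : ∀ v, fderiv ℂ T w v = ⟪a, v⟫_ℂ := fun v => by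
    rw [ha, InnerProductSpace.toDual_symm_apply]
  have ha0 : a ≠ 0 := by
    intro h; exact hdT (by ext v; simp [hav, h])
  have han : (0 : ℝ) < ‖a‖ := norm_pos_iff.2 ha0
  refine ⟨((‖a‖⁻¹ : ℝ) : ℂ) • a, ?_, ⟨(‖a‖ : ℂ), by exact_mod_cast han.ne', ?_⟩, ?_⟩
  · rw [norm_smul, Complex.norm_real, Real.norm_of_nonneg (by positivity), inv_mul_cancel₀ han.ne']
  · intro v
    rw [hav, inner_smul_left, Complex.conj_ofReal, ← mul_assoc, ← Complex.ofReal_mul,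
      mul_inv_cancel₀ han.ne', Complex.ofReal_one, one_mul]
  set ν : En n := ((‖a‖⁻¹ : ℝ) : ℂ) • a with hν
  have hνn : ‖ν‖ = 1 := by
    rw [hν, norm_smul, Complex.norm_real, Real.norm_of_nonneg (by positivity),
      inv_mul_cancel₀ han.ne']
  obtain ⟨K, hK0, hK⟩ := exists_norm_sub_fderiv_le hT w
  have hTW : ∀ x ∈ W, T x = 0 := fun x hx => by rw [hW] at hx; exact hx
  have hnear : ∀ b ∈ W, ‖b - w‖ < 1 → ‖⟪ν, b - w⟫_ℂ‖ ≤ K / ‖a‖ * ‖b - w‖ ^ 2 := by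
    intro b hb hbw
    have h := hK b (by rwa [mem_ball, dist_eq_norm])
    rw [hTW b hb, hTW w hw, hav] at h
    simp only [sub_zero, zero_sub, norm_neg] at h
    rw [hν, inner_smul_left, Complex.conj_ofReal, norm_mul, Complex.norm_real,
      Real.norm_of_nonneg (by positivity), div_mul_eq_mul_div, le_div_iff₀ han]
    calc _ = ‖⟪a, b - w⟫_ℂ‖ * (‖a‖⁻¹ * ‖a‖) := by ring
      _ ≤ _ := by rw [inv_mul_cancel₀ han.ne', mul_one]; exact h
  -- short normal segments in every complex direction of the normal line are minimizing
  have hexp : ∀ (ν' : En n), ‖ν'‖ = 1 → ∀ (s : ℝ) (x : En n), ‖w + s • ν' - x‖ ^ 2 =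
      s ^ 2 - 2 * s * (⟪ν', x - w⟫_ℂ).re + ‖x - w‖ ^ 2 := by
    intro ν' hν' s x
    have e1 : w + s • ν' - x = s • ν' - (x - w) := by abel
    rw [e1, @norm_sub_sq ℂ, ← Complex.coe_smul, inner_smul_left, Complex.conj_ofReal, norm_smul,
      Complex.norm_real, hν', Real.norm_eq_abs, mul_one, sq_abs, RCLike.re_to_complex,
      Complex.re_ofReal_mul]
    ring
  have hray : ∀ ν' : En n, ‖ν'‖ = 1 → (∀ v, ‖⟪ν', v⟫_ℂ‖ = ‖⟪ν, v⟫_ℂ‖) →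
      infDist (w + r • ν') W = r := by
    intro ν' hν' hphase
    set s := min (min (‖a‖ / (2 * K)) (1 / 2)) r with hs
    have hs0 : 0 < s := by positivity
    have hs1 : s ≤ ‖a‖ / (2 * K) := (min_le_left _ _).trans (min_le_left _ _)
    have hs2 : s ≤ 1 / 2 := (min_le_left _ _).trans (min_le_right _ _)
    have hsr : s ≤ r := min_le_right _ _
    refine infDist_normal_ray (hprc.continuousOn) hpr hw hν' hs0 ?_ hsr hr
    apply le_antisymm
    · refine (infDist_le_dist_of_mem hw).trans ?_
      rw [dist_eq_norm, add_sub_cancel_left, norm_smul, hν', mul_one, Real.norm_of_nonneg hs0.le]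
    · refine (le_infDist ⟨w, hw⟩).2 fun b hb => ?_
      rw [dist_eq_norm]
      rcases lt_or_ge ‖b - w‖ 1 with h | h
      · have h1 := hnear b hb h
        have h2 := (Complex.re_le_norm (⟪ν', b - w⟫_ℂ))
        rw [hphase] at h2
        have h3 : 2 * s * (⟪ν', b - w⟫_ℂ).re ≤ ‖b - w‖ ^ 2 := by
          have h4 : 2 * s * (K / ‖a‖) ≤ 1 := by
            rw [mul_div_assoc', div_le_one han]
            rw [le_div_iff₀ (by positivity)] at hs1
            linarith
          calc 2 * s * (⟪ν', b - w⟫_ℂ).re ≤ 2 * s * (K / ‖a‖ * ‖b - w‖ ^ 2) := by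
                gcongr; exact h2.trans h1
            _ = 2 * s * (K / ‖a‖) * ‖b - w‖ ^ 2 := by ring
            _ ≤ 1 * ‖b - w‖ ^ 2 := by gcongr
            _ = _ := one_mul _
        have h5 := hexp ν' hν' s b
        exact le_of_sq_le_sq (by nlinarith) (norm_nonneg _)
      · have e1 : b - w = s • ν' - (w + s • ν' - b) := by abel
        have h6 := norm_sub_le (s • ν') (w + s • ν' - b)
        rw [← e1, norm_smul, hν', mul_one, Real.norm_of_nonneg hs0.le] at h6
        linarith
  intro x hx
  obtain ⟨u, hu1, hu2⟩ : ∃ u : ℂ, ‖u‖ = 1 ∧ u * ⟪ν, x - w⟫_ℂ = ‖⟪ν, x - w⟫_ℂ‖ := by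
    by_cases h0 : ⟪ν, x - w⟫_ℂ = 0
    · exact ⟨1, by simp, by simp [h0]⟩
    · have hp : (‖⟪ν, x - w⟫_ℂ‖ : ℂ) ≠ 0 := by exact_mod_cast norm_ne_zero_iff.2 h0
      refine ⟨‖⟪ν, x - w⟫_ℂ‖ / ⟪ν, x - w⟫_ℂ, ?_, div_mul_cancel₀ _ h0⟩
      rw [norm_div, Complex.norm_real, norm_norm, div_self (norm_ne_zero_iff.2 h0)]
  have hcon : ‖(starRingEnd ℂ) u‖ = 1 := by rw [RCLike.norm_conj, hu1]
  have hν' : ‖(starRingEnd ℂ) u • ν‖ = 1 := by rw [norm_smul, hcon, hνn, mul_one]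
  have h1 := hray ((starRingEnd ℂ) u • ν) hν' (fun v => by
    rw [inner_smul_left, Complex.conj_conj, norm_mul, hu1, one_mul])
  have h2 : r ≤ ‖w + r • ((starRingEnd ℂ) u • ν) - x‖ := by
    rw [← dist_eq_norm]
    conv_lhs => rw [← h1]
    exact infDist_le_dist_of_mem hx
  have h3 := hexp _ hν' r x
  rw [inner_smul_left, Complex.conj_conj, hu2, Complex.ofReal_re] at h3
  nlinarith

end QuadraticContact

section ZeroSelection

/-- The derivative of a continuous family of entire functions is jointly continuous. -/
theorem continuous_deriv_family {X : Type*} [TopologicalSpace X] {f : X → ℂ → ℂ}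
    (hc : Continuous (Function.uncurry f)) (hd : ∀ x, Differentiable ℂ (f x)) :
    Continuous fun p : X × ℂ => deriv (f p.1) p.2 := by
  rw [continuous_iff_continuousAt]
  rintro ⟨x₀, ζ₀⟩
  rw [ContinuousAt, Metric.tendsto_nhds]
  intro δ hδ
  have hev := (isCompact_closedBall (0 : ℂ) 1).eventually_forall_of_forall_eventually
    (P := fun (p : X × ℂ) (a : ℂ) => ‖(f p.1 (p.2 + a) - f p.1 p.2) -
      (f x₀ (ζ₀ + a) - f x₀ ζ₀)‖ < δ / 2) (x₀ := (x₀, ζ₀)) (fun a _ => by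
      have h : Continuous fun q : (X × ℂ) × ℂ => ‖(f q.1.1 (q.1.2 + q.2) - f q.1.1 q.1.2) -
          (f x₀ (ζ₀ + q.2) - f x₀ ζ₀)‖ := by
        have h1 : Continuous fun q : (X × ℂ) × ℂ => f q.1.1 (q.1.2 + q.2) :=
          hc.comp (f := fun q : (X × ℂ) × ℂ => (q.1.1, q.1.2 + q.2)) (by fun_prop)
        have h2 : Continuous fun q : (X × ℂ) × ℂ => f q.1.1 q.1.2 :=
          hc.comp (f := fun q : (X × ℂ) × ℂ => q.1) (by fun_prop)
        have h3 := (hd x₀).continuous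
        fun_prop
      exact h.continuousAt.eventually_lt_const (by simpa using half_pos hδ))
  filter_upwards [hev] with p hp
  set h : ℂ → ℂ := fun a => (f p.1 (p.2 + a) - f p.1 p.2) - (f x₀ (ζ₀ + a) - f x₀ ζ₀) with hh
  have hshift : ∀ (x : X) (ζ : ℂ), HasDerivAt (fun a => f x (ζ + a) - f x ζ) (deriv (f x) ζ) 0 := by
    intro x ζ
    have h1 : HasDerivAt (f x) (deriv (f x) ζ) (ζ + 0) := by
      rw [add_zero]; exact (hd x ζ).hasDerivAt
    exact (h1.comp_const_add ζ 0).sub_const _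
  have hder : HasDerivAt h (deriv (f p.1) p.2 - deriv (f x₀) ζ₀) 0 :=
    (hshift p.1 p.2).sub (hshift x₀ ζ₀)
  have hdiff : Differentiable ℂ h := by
    have h1 := hd p.1
    have h2 := hd x₀
    fun_prop
  have h0 : h 0 = 0 := by simp [hh]
  have hb := Complex.norm_deriv_le_div_of_mapsTo_ball (f := h) (c := 0) (R₁ := 1) (R₂ := δ / 2)
    hdiff.differentiableOn (fun a ha => by
      rw [h0, mem_closedBall_zero_iff]
      exact (hp a (ball_subset_closedBall ha)).le) one_pos
  rw [hder.deriv, div_one] at hb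
  rw [dist_eq_norm]
  linarith

/-- The divided difference of a continuous family of entire functions is jointly continuous. -/
theorem continuous_dslope_family {X : Type*} [TopologicalSpace X] {f : X → ℂ → ℂ}
    (hc : Continuous (Function.uncurry f)) (hd : ∀ x, Differentiable ℂ (f x)) :
    Continuous fun p : X × ℂ × ℂ => dslope (f p.1) p.2.1 p.2.2 := by
  have hder := continuous_deriv_family hc hd
  have key : ∀ p : X × ℂ × ℂ, dslope (f p.1) p.2.1 p.2.2 =
      ∫ s in (0 : ℝ)..1, deriv (f p.1) (p.2.1 + s * (p.2.2 - p.2.1)) := by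
    rintro ⟨x, α, β⟩
    have hint : IntervalIntegrable (fun s : ℝ => deriv (f x) (α + s * (β - α))) volume 0 1 :=
      (hder.comp (f := fun s : ℝ => (x, α + s * (β - α))) (by fun_prop)).intervalIntegrable _ _
    rcases eq_or_ne β α with rfl | hne
    · simp
    · have h1 : ∀ s : ℝ, HasDerivAt (fun s : ℝ => f x (α + s * (β - α)))
          (deriv (f x) (α + s * (β - α)) * (β - α)) s := by
        intro s
        have h2 : HasDerivAt (fun s : ℝ => α + (s : ℂ) * (β - α)) (β - α) s := by
          simpa using (((hasDerivAt_id s).ofReal_comp).mul_const (β - α)).const_add α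
        exact HasDerivAt.comp s (hd x _).hasDerivAt h2
      have h3 := intervalIntegral.integral_eq_sub_of_hasDerivAt (a := 0) (b := 1)
        (fun s _ => h1 s) (hint.mul_const _)
      rw [intervalIntegral.integral_mul_const] at h3
      simp only [Complex.ofReal_one, one_mul, Complex.ofReal_zero, zero_mul, add_zero,
        add_sub_cancel] at h3
      have h4 := sub_smul_dslope (f x) α β
      rw [smul_eq_mul] at h4
      have h5 : β - α ≠ 0 := sub_ne_zero.2 hne
      exact mul_left_cancel₀ h5 (by rw [h4, ← h3]; ring)
  simp only [key]
  refine intervalIntegral.continuous_parametric_intervalIntegral_of_continuous' ?_ 0 1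
  exact hder.comp (f := fun q : (X × ℂ × ℂ) × ℝ => (q.1.1, q.1.2.1 + q.2 * (q.1.2.2 - q.1.2.1)))
    (by fun_prop)

/-- Zeros of a continuous family of entire functions persist under perturbation. -/
theorem eventually_exists_zero_mem_ball {X : Type*} [TopologicalSpace X] {f : X → ℂ → ℂ}
    (hc : Continuous (Function.uncurry f)) (hd : ∀ x, Differentiable ℂ (f x)) {x₀ : X}
    {c ζ₀ : ℂ} {ρ : ℝ} (hζ₀ : ζ₀ ∈ ball c ρ) (h0 : f x₀ ζ₀ = 0)
    (hs : ∀ ζ ∈ sphere c ρ, f x₀ ζ ≠ 0) :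
    ∀ᶠ x in 𝓝 x₀, ∃ ζ ∈ ball c ρ, f x ζ = 0 := by
  have hρ : 0 < ρ := pos_of_mem_ball hζ₀
  have hcx : ∀ ζ, Continuous fun x => f x ζ := fun ζ =>
    hc.comp (f := fun x => (x, ζ)) (by fun_prop)
  obtain ⟨ζ₁, hζ₁, hmin⟩ := (isCompact_sphere c ρ).exists_isMinOn
    (NormedSpace.sphere_nonempty.2 hρ.le) (f := fun ζ => ‖f x₀ ζ‖)
    (hd x₀).continuous.norm.continuousOn
  set m := ‖f x₀ ζ₁‖ with hm
  have hm0 : 0 < m := norm_pos_iff.2 (hs ζ₁ hζ₁)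
  have hev1 := (isCompact_sphere c ρ).eventually_forall_of_forall_eventually
    (P := fun x ζ => m / 2 < ‖f x ζ‖) (x₀ := x₀) (fun ζ hζ =>
      (hc.norm.continuousAt (x := (x₀, ζ))).eventually_const_lt
        ((half_lt_self hm0).trans_le (hmin hζ)))
  have hev2 : ∀ᶠ x in 𝓝 x₀, ‖f x ζ₀‖ < m / 2 :=
    (hcx ζ₀).norm.continuousAt.eventually_lt_const (by
      show ‖f x₀ ζ₀‖ < m / 2
      rw [h0, norm_zero]
      positivity)
  filter_upwards [hev1, hev2] with x hx1 hx2
  by_contra hno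
  push Not at hno
  have hne : ∀ ζ ∈ closedBall c ρ, f x ζ ≠ 0 := by
    intro ζ hζ
    rcases (mem_closedBall.1 hζ).lt_or_eq with h | h
    · exact hno ζ h
    · intro h1
      have := hx1 ζ h
      rw [h1, norm_zero] at this
      linarith
  have hg : DiffContOnCl ℂ (fun ζ => (f x ζ)⁻¹) (ball c ρ) := by
    refine DifferentiableOn.diffContOnCl_ball (U := closedBall c ρ) ?_ subset_rfl
    exact (hd x).differentiableOn.inv hne
  have h1 := Complex.norm_le_of_forall_mem_frontier_norm_le isBounded_ball hg (C := (m / 2)⁻¹)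
    (fun ζ hζ => by
      rw [frontier_ball c hρ.ne'] at hζ
      rw [norm_inv]
      exact inv_anti₀ (by positivity) (hx1 ζ hζ).le) (subset_closure hζ₀)
  rw [norm_inv] at h1
  have h2 : 0 < ‖f x ζ₀‖ := norm_pos_iff.2 (hno ζ₀ hζ₀)
  exact absurd ((inv_le_inv₀ h2 (by positivity)).1 h1) (not_le.2 hx2)

/-- The product of a differentiable function vanishing at a point with a function continuous there
is differentiable at this point. -/
theorem differentiableAt_mul_of_eq_zero {V : Type*} [NormedAddCommGroup V] [NormedSpace ℂ V]
    {u c : V → ℂ} {t : V} (hu : DifferentiableAt ℂ u t) (h0 : u t = 0) (hc : ContinuousAt c t) :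
    DifferentiableAt ℂ (fun s => u s * c s) t := by
  refine ⟨c t • fderiv ℂ u t, .of_isLittleO ?_⟩
  have h1 := hu.hasFDerivAt.isLittleO
  have h2 : (fun s => u s) =O[𝓝 t] fun s => s - t := by
    simpa [h0] using hu.hasFDerivAt.isBigO_sub
  have h3 : (fun s => c s - c t) =o[𝓝 t] fun _ => (1 : ℝ) := by
    rw [Asymptotics.isLittleO_one_iff]
    simpa using hc.sub_const (c t)
  have h4 := (h2.norm_right.mul_isLittleO h3)
  have h5 := (h1.const_mul_left (c t)).norm_right
  simp only [mul_one] at h4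
  refine ((h4.add h5).congr_left fun s => ?_).of_norm_right
  simp [h0]; ring

end ZeroSelection

section ZeroGraph

/-- A property which is open, and whose negation is open, propagates along preconnected sets. -/
theorem IsPreconnected.forall_of_eventually {X : Type*} [TopologicalSpace X] {s : Set X}
    (hs : IsPreconnected s) {P : X → Prop} (h1 : ∀ x ∈ s, P x → ∀ᶠ y in 𝓝 x, P y)
    (h2 : ∀ x ∈ s, ¬ P x → ∀ᶠ y in 𝓝 x, ¬ P y) {x₀ : X} (hx₀ : x₀ ∈ s) (h0 : P x₀) :
    ∀ x ∈ s, P x := by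
  have hsub := IsPreconnected.subset_left_of_subset_union
    (u := {x | ∀ᶠ y in 𝓝 x, P y}) (v := {x | ∀ᶠ y in 𝓝 x, ¬ P y})
    isOpen_setOfPred_eventually_nhds isOpen_setOfPred_eventually_nhds
    (Set.disjoint_left.2 fun x (hx : ∀ᶠ y in 𝓝 x, P y) (hx' : ∀ᶠ y in 𝓝 x, ¬ P y) =>
      hx'.self_of_nhds hx.self_of_nhds)
    (fun x hx => by
      by_cases h : P x
      · exact Or.inl (h1 x hx h)
      · exact Or.inr (h2 x hx h))
    ⟨x₀, hx₀, h1 x₀ hx₀ h0⟩ hs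
  exact fun x hx => (hsub hx).self_of_nhds

/-- Zeros of a nontrivial entire function are isolated by small circles. -/
theorem exists_sphere_ne_zero {h : ℂ → ℂ} (hh : Differentiable ℂ h) {z : ℂ} (hz : h z ≠ 0)
    (α : ℂ) {δ : ℝ} (hδ : 0 < δ) : ∃ ρ, 0 < ρ ∧ ρ < δ ∧ ∀ ζ ∈ sphere α ρ, h ζ ≠ 0 := by
  have han : AnalyticOnNhd ℂ h univ := fun x _ => hh.analyticAt x
  rcases (hh.analyticAt α).eventually_eq_zero_or_eventually_ne_zero with h0 | h0
  · exact absurd (congrFun (han.eq_of_eventuallyEq (g := fun _ => 0) analyticOnNhd_const h0) z) hz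
  · obtain ⟨η, hη, hb⟩ := Metric.eventually_nhds_iff.1 (eventually_nhdsWithin_iff.1 h0)
    have hm : 0 < min η δ := lt_min hη hδ
    refine ⟨min η δ / 2, by positivity, (half_lt_self hm).trans_le (min_le_right _ _), ?_⟩
    intro ζ hζ
    have hd : dist ζ α = min η δ / 2 := hζ
    refine hb (hd.trans_lt ((half_lt_self hm).trans_le (min_le_left _ _))) ?_
    rintro rfl
    rw [dist_self] at hd
    linarith

variable {V : Type*} [NormedAddCommGroup V] [NormedSpace ℝ V] [NormedSpace ℂ V]

/-- A holomorphic family of entire functions whose zeros in the closed disc of radius `ε` stay in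
the disc of radius `ε / 2`, and which has exactly one zero in that disc at the parameter `0`, which
is simple, has exactly one zero for all parameters, depending holomorphically on the parameter. -/
theorem exists_differentiableOn_zero_graph {f : V → ℂ → ℂ}
    (hf : Differentiable ℂ (Function.uncurry f)) {ε : ℝ} (hε : 0 < ε)
    (H : ∀ t ∈ ball (0 : V) ε, ∀ ζ, ‖ζ‖ ≤ ε → f t ζ = 0 → ‖ζ‖ < ε / 2)
    (h00 : f 0 0 = 0) (h0 : ∀ ζ, ‖ζ‖ ≤ ε → f 0 ζ = 0 → ζ = 0) (hd0 : deriv (f 0) 0 ≠ 0) :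
    ∃ γ : V → ℂ, DifferentiableOn ℂ γ (ball 0 ε) ∧ ∀ t ∈ ball (0 : V) ε,
      f t (γ t) = 0 ∧ ‖γ t‖ < ε / 2 ∧ ∀ ζ, ‖ζ‖ ≤ ε → f t ζ = 0 → ζ = γ t := by
  have hc := hf.continuous
  have hd : ∀ t, Differentiable ℂ (f t) := fun t =>
    hf.comp (f := fun ζ => (t, ζ)) (by fun_prop)
  have hfα : ∀ ζ, Differentiable ℂ fun t => f t ζ := fun ζ =>
    hf.comp (f := fun t => (t, ζ)) (by fun_prop)
  have hD := continuous_dslope_family hc hd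
  have hDd : ∀ t α, Differentiable ℂ (dslope (f t) α) := fun t α =>
    differentiableOn_univ.1 ((Complex.differentiableOn_dslope Filter.univ_mem).2
      (hd t).differentiableOn)
  have hDf : ∀ t α β, f t α = 0 → (β - α) * dslope (f t) α β = f t β := fun t α β h => by
    have := sub_smul_dslope (f t) α β
    rwa [smul_eq_mul, h, sub_zero] at this
  have hs : ∀ t ∈ ball (0 : V) ε, ∀ ζ ∈ sphere (0 : ℂ) ε, f t ζ ≠ 0 := by
    intro t ht ζ hζ h
    have e : ‖ζ‖ = ε := mem_sphere_zero_iff_norm.1 hζ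
    have := H t ht ζ e.le h
    linarith
  have hmem : ∀ {t}, t ∈ ball (0 : V) ε → ∀ᶠ s in 𝓝 t, s ∈ ball (0 : V) ε := fun ht =>
    isOpen_ball.mem_nhds ht
  have hconn : IsPreconnected (ball (0 : V) ε) := (convex_ball 0 ε).isPreconnected
  -- existence of zeros
  have hP : ∀ t ∈ ball (0 : V) ε, ∃ ζ ∈ closedBall (0 : ℂ) ε, f t ζ = 0 := by
    refine hconn.forall_of_eventually (fun t ht h => ?_) (fun t ht h => ?_) (mem_ball_self hε)
      ⟨0, mem_closedBall_self hε.le, h00⟩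
    · obtain ⟨ζ, hζ, hz⟩ := h
      have hζ' := H t ht ζ (mem_closedBall_zero_iff.1 hζ) hz
      refine (eventually_exists_zero_mem_ball hc hd (mem_ball_zero_iff.2 (by linarith)) hz
        (hs t ht)).mono fun s ⟨ζ', h1, h2⟩ => ⟨ζ', ball_subset_closedBall h1, h2⟩
    · push Not at h
      refine ((isCompact_closedBall (0 : ℂ) ε).eventually_forall_of_forall_eventually
        (P := fun s ζ => f s ζ ≠ 0) (x₀ := t) fun ζ hζ =>
          (hc.continuousAt (x := (t, ζ))).eventually_ne (h ζ hζ)).mono fun s hs' => ?_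
      push Not
      exact hs'
  -- uniqueness and simplicity of zeros
  have hQ : ∀ t ∈ ball (0 : V) ε, ∀ a ∈ closedBall (0 : ℂ) ε ×ˢ closedBall (0 : ℂ) ε,
      f t a.1 = 0 → dslope (f t) a.1 a.2 ≠ 0 := by
    refine hconn.forall_of_eventually (fun t ht h => ?_) (fun t ht h => ?_) (mem_ball_self hε) ?_
    · refine ((isCompact_closedBall (0 : ℂ) ε).prod
        (isCompact_closedBall (0 : ℂ) ε)).eventually_forall_of_forall_eventually
        (P := fun s a => f s a.1 = 0 → dslope (f s) a.1 a.2 ≠ 0) (x₀ := t) fun a ha => ?_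
      by_cases hz : f t a.1 = 0
      · exact ((hD.continuousAt (x := (t, a))).eventually_ne (h a ha hz)).mono fun _ h _ => h
      · have h1 : Continuous fun z : V × ℂ × ℂ => f z.1 z.2.1 :=
          hc.comp (f := fun z : V × ℂ × ℂ => (z.1, z.2.1)) (by fun_prop)
        exact ((h1.continuousAt (x := (t, a))).eventually_ne hz).mono fun _ h h' => absurd h' h
    · push Not at h
      obtain ⟨⟨α, β⟩, ⟨hα, hβ⟩, hz, hDz⟩ := h
      simp only [mem_closedBall_zero_iff] at hα hβ hz hDz
      have hz' : f t β = 0 := by rw [← hDf t α β hz, hDz, mul_zero]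
      have hα' := H t ht α hα hz
      have hβ' := H t ht β hβ hz'
      have hev := eventually_exists_zero_mem_ball (X := V × ℂ)
        (f := fun z ζ => dslope (f z.1) z.2 ζ) (x₀ := (t, α)) (c := 0) (ρ := ε) (ζ₀ := β)
        (hD.comp (f := fun q : (V × ℂ) × ℂ => (q.1.1, q.1.2, q.2)) (by fun_prop))
        (fun z => hDd z.1 z.2) (mem_ball_zero_iff.2 (by linarith)) hDz
        (fun ζ hζ h => hs t ht ζ hζ (by rw [← hDf t α ζ hz, h, mul_zero]))
      rw [nhds_prod_eq, Filter.eventually_prod_iff] at hev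
      obtain ⟨pa, hpa, pb, hpb, hab⟩ := hev
      obtain ⟨δ, hδ, hb⟩ := Metric.eventually_nhds_iff.1 hpb
      obtain ⟨ρ, hρ0, hρ, hρs⟩ := exists_sphere_ne_zero (hd t)
        (hs t ht (ε : ℂ) (by simp [hε.le])) α (lt_min hδ (half_pos hε))
      have hev2 := eventually_exists_zero_mem_ball hc hd (mem_ball_self hρ0) hz hρs
      filter_upwards [hpa, hev2] with s hs1 ⟨α', hα1, hα2⟩
      have hα3 : dist α' α < ρ := hα1
      obtain ⟨β', hβ1, hβ2⟩ := hab hs1 (hb (hα3.trans (hρ.trans_le (min_le_left _ _))))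
      push Not
      refine ⟨(α', β'), ⟨?_, ball_subset_closedBall hβ1⟩, hα2, hβ2⟩
      rw [mem_closedBall_zero_iff]
      have h3 : ‖α'‖ ≤ ‖α' - α‖ + ‖α‖ := by simpa using norm_add_le (α' - α) α
      rw [dist_eq_norm] at hα3
      have := hρ.trans_le (min_le_right _ _)
      linarith
    · rintro ⟨α, β⟩ ⟨hα, hβ⟩ hz hDz
      simp only [mem_closedBall_zero_iff] at hα hβ hz hDz
      have hz' : f 0 β = 0 := by rw [← hDf 0 α β hz, hDz, mul_zero]
      rw [h0 α hα hz, h0 β hβ hz', dslope_same] at hDz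
      exact hd0 hDz
  choose! γ hγ1 hγ2 using hP
  have huniq : ∀ t ∈ ball (0 : V) ε, ∀ ζ, ‖ζ‖ ≤ ε → f t ζ = 0 → ζ = γ t := by
    intro t ht ζ hζ hz
    have h1 := hQ t ht (γ t, ζ) ⟨hγ1 t ht, mem_closedBall_zero_iff.2 hζ⟩ (hγ2 t ht)
    have h2 := hDf t (γ t) ζ (hγ2 t ht)
    rw [hz] at h2
    exact sub_eq_zero.1 ((mul_eq_zero.1 h2).resolve_right h1)
  have hγ3 : ∀ t ∈ ball (0 : V) ε, ‖γ t‖ < ε / 2 := fun t ht =>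
    H t ht _ (mem_closedBall_zero_iff.1 (hγ1 t ht)) (hγ2 t ht)
  have hγc : ∀ t ∈ ball (0 : V) ε, ContinuousAt γ t := by
    intro t ht
    rw [ContinuousAt, Metric.tendsto_nhds]
    intro η hη
    obtain ⟨ρ, hρ0, hρ, hρs⟩ := exists_sphere_ne_zero (hd t)
      (hs t ht (ε : ℂ) (by simp [hε.le])) (γ t) (lt_min hη (half_pos hε))
    filter_upwards [eventually_exists_zero_mem_ball hc hd (mem_ball_self hρ0) (hγ2 t ht) hρs,
      hmem ht] with s ⟨ζ, hζ1, hζ2⟩ hs'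
    have hζ3 : dist ζ (γ t) < ρ := hζ1
    have h3 : ‖ζ‖ ≤ ‖ζ - γ t‖ + ‖γ t‖ := by simpa using norm_add_le (ζ - γ t) (γ t)
    rw [← huniq s hs' ζ (by
      rw [dist_eq_norm] at hζ3
      have := hρ.trans_le (min_le_right _ _)
      have := hγ3 t ht
      linarith) hζ2]
    exact hζ3.trans (hρ.trans_le (min_le_left _ _))
  refine ⟨γ, fun t ht => DifferentiableAt.differentiableWithinAt ?_, fun t ht =>
    ⟨hγ2 t ht, hγ3 t ht, huniq t ht⟩⟩
  have hDc : ContinuousAt (fun s => dslope (f s) (γ t) (γ s)) t :=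
    (hD.continuousAt (x := (t, γ t, γ t))).comp (f := fun s => (s, γ t, γ s))
      (continuousAt_id.prodMk (continuousAt_const.prodMk (hγc t ht)))
  have hDne : dslope (f t) (γ t) (γ t) ≠ 0 := hQ t ht (γ t, γ t) ⟨hγ1 t ht, hγ1 t ht⟩ (hγ2 t ht)
  have hmain := (differentiableAt_mul_of_eq_zero (hfα (γ t) t) (hγ2 t ht)
    (hDc.inv₀ hDne).neg).const_add (γ t)
  refine hmain.congr_of_eventuallyEq ?_
  filter_upwards [hmem ht, hDc.eventually_ne hDne] with s hs1 hs2
  have h1 := sub_smul_dslope (f s) (γ t) (γ s)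
  rw [hγ2 s hs1, smul_eq_mul, zero_sub] at h1
  have h2 : γ s - γ t = -f s (γ t) * (dslope (f s) (γ t) (γ s))⁻¹ := by
    rw [← h1, mul_assoc, mul_inv_cancel₀ hs2, mul_one]
  simp only [Pi.neg_apply, Pi.inv_apply]
  linear_combination h2

end ZeroGraph

section GraphCoordinates

open scoped InnerProductSpace

/-- The splitting `ℂᵐ⁺¹ ≅ ℂᵐ × ℂ` separating the first coordinate from the other ones. -/
def splitFirst (m : ℕ) : En (m + 1) ≃L[ℂ] En m × ℂ :=
  LinearEquiv.toContinuousLinearEquiv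
    { toFun := fun y => (WithLp.toLp 2 fun i => y i.succ, y 0)
      invFun := fun a => WithLp.toLp 2 (Fin.cons a.2 a.1)
      map_add' := fun _ _ => rfl
      map_smul' := fun _ _ => rfl
      left_inv := fun y => by
        ext i
        refine Fin.cases ?_ (fun i => ?_) i <;> simp
      right_inv := fun a => by
        ext i <;> simp }

theorem splitFirst_snd {m : ℕ} (y : En (m + 1)) : (splitFirst m y).2 = y 0 := rfl

theorem splitFirst_symm_zero_one (m : ℕ) :
    (splitFirst m).symm (0, 1) = EuclideanSpace.single 0 1 := by
  rw [ContinuousLinearEquiv.symm_apply_eq]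
  ext i
  · show (0 : ℂ) = EuclideanSpace.single (0 : Fin (m + 1)) (1 : ℂ) i.succ
    simp
  · show (1 : ℂ) = EuclideanSpace.single (0 : Fin (m + 1)) (1 : ℂ) 0
    simp

theorem norm_sq_eq_splitFirst {m : ℕ} (y : En (m + 1)) :
    ‖y‖ ^ 2 = ‖(splitFirst m y).1‖ ^ 2 + ‖(splitFirst m y).2‖ ^ 2 := by
  rw [EuclideanSpace.norm_sq_eq, EuclideanSpace.norm_sq_eq, Fin.sum_univ_succ, add_comm]
  rfl

theorem norm_splitFirst_fst_le {m : ℕ} (y : En (m + 1)) : ‖(splitFirst m y).1‖ ≤ ‖y‖ := by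
  have h := norm_sq_eq_splitFirst y
  exact le_of_sq_le_sq (by nlinarith [sq_nonneg ‖(splitFirst m y).2‖]) (norm_nonneg _)

theorem norm_splitFirst_snd_le {m : ℕ} (y : En (m + 1)) : ‖(splitFirst m y).2‖ ≤ ‖y‖ := by
  have h := norm_sq_eq_splitFirst y
  exact le_of_sq_le_sq (by nlinarith [sq_nonneg ‖(splitFirst m y).1‖]) (norm_nonneg _)

/-- Every unit vector is the first vector of a unitary frame. -/
theorem exists_linearIsometryEquiv_symm_single {m : ℕ} {ν : En (m + 1)} (hν : ‖ν‖ = 1) :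
    ∃ U : En (m + 1) ≃ₗᵢ[ℂ] En (m + 1), U.symm (EuclideanSpace.single 0 1) = ν ∧
      ∀ v, (U v) 0 = ⟪ν, v⟫_ℂ := by
  obtain ⟨b, hb⟩ := Orthonormal.exists_orthonormalBasis_extension_of_card_eq (𝕜 := ℂ)
    (E := En (m + 1)) (ι := Fin (m + 1)) (by simp) (v := fun _ => ν) (s := {0}) (by
      rw [orthonormal_iff_ite]
      rintro ⟨i, rfl⟩ ⟨j, rfl⟩
      simp [hν])
  have hb0 : b 0 = ν := hb 0 rfl
  refine ⟨b.repr, ?_, fun v => ?_⟩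
  · rw [b.repr_symm_single, hb0]
  · rw [b.repr_apply_apply, hb0]

/-- In the ball of radius `ε` about a point, a uniformly flat hypersurface is contained in a
holomorphic graph over the tangent space, which in turn is contained in the hypersurface. -/
theorem exists_graph_coordinates {m : ℕ} {T : En (m + 1) → ℂ} {W : Set (En (m + 1))} {ε₀ ε : ℝ}
    (hT : Differentiable ℂ T) (hW : W = T ⁻¹' {0}) (hflat : UniformlyFlatWith ε₀ W)
    {w : En (m + 1)} (hw : w ∈ W) (hdT : fderiv ℂ T w ≠ 0) (hε : 0 < ε) (hεε₀ : ε < ε₀ / 2) :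
    ∃ (U : En (m + 1) ≃ₗᵢ[ℂ] En (m + 1)) (x : En m → En (m + 1)),
      DifferentiableOn ℂ x (ball 0 ε) ∧
      (∀ t ∈ ball (0 : En m) ε, x t ∈ W ∩ ball w (2 * ε) ∧
        (splitFirst m (U (x t - w))).1 = t) ∧
      ∀ z ∈ ball w ε ∩ W, x (splitFirst m (U (z - w))).1 = z := by
  obtain ⟨ν, hν, ⟨c, hc, hTc⟩, hcontact⟩ := exists_unit_normal_quadratic_contact
    (r := (2 * ε + ε₀) / 2) hT hW hflat hw hdT (by linarith) (by linarith)
  obtain ⟨U, hU1, hU2⟩ := exists_linearIsometryEquiv_symm_single hν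
  have memW : ∀ z, z ∈ W ↔ T z = 0 := fun z => by rw [hW]; rfl
  set Λ : En m × ℂ → En (m + 1) := fun a => U.symm ((splitFirst m).symm a) with hΛ
  have hΛd : Differentiable ℂ Λ :=
    U.symm.toContinuousLinearEquiv.differentiable.comp (splitFirst m).symm.differentiable
  have hUΛ : ∀ a, splitFirst m (U (Λ a)) = a := fun a => by simp [hΛ]
  have hΛU : ∀ v, Λ (splitFirst m (U v)) = v := fun v => by simp [hΛ]
  have hΛn : ∀ a, ‖Λ a‖ ^ 2 = ‖a.1‖ ^ 2 + ‖a.2‖ ^ 2 := fun a => by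
    have h := norm_sq_eq_splitFirst (U (Λ a))
    rwa [hUΛ, U.norm_map] at h
  have hΛν : ∀ a, ⟪ν, Λ a⟫_ℂ = a.2 := fun a => by
    rw [← hU2, ← splitFirst_snd, hUΛ]
  have hΛ0 : Λ (0, 1) = ν := by rw [hΛ]; simp only [splitFirst_symm_zero_one, hU1]
  have hctc : ∀ t ζ, T (w + Λ (t, ζ)) = 0 →
      (2 * ε + ε₀) * ‖ζ‖ ≤ ‖t‖ ^ 2 + ‖ζ‖ ^ 2 := by
    intro t ζ h
    have h1 := hcontact _ ((memW _).2 h)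
    rw [add_sub_cancel_left, hΛν, hΛn] at h1
    linarith
  set f : En m → ℂ → ℂ := fun t ζ => T (w + Λ (t, ζ)) with hfdef
  have hfd : Differentiable ℂ (Function.uncurry f) := by
    have : Function.uncurry f = fun a => T (w + Λ a) := rfl
    rw [this]
    exact hT.comp (hΛd.const_add w)
  obtain ⟨γ, hγd, hγ⟩ := exists_differentiableOn_zero_graph (V := En m) hfd hε
    (fun t ht ζ hζ h => by
      have h1 := hctc t ζ h
      have h2 : ‖t‖ < ε := mem_ball_zero_iff.1 ht
      nlinarith [norm_nonneg ζ, norm_nonneg t])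
    (by
      show T (w + Λ (0, 0)) = 0
      have : Λ (0, 0) = 0 := by simp [hΛ, ← Prod.zero_eq_mk]
      rw [this, add_zero]
      exact (memW w).1 hw)
    (fun ζ hζ h => by
      have h1 := hctc 0 ζ h
      rw [norm_zero] at h1
      exact norm_le_zero_iff.1 (by nlinarith [norm_nonneg ζ]))
    (by
      have hz : ∀ ζ : ℂ, Λ (0, ζ) = ζ • ν := fun ζ => by
        rw [← hΛ0, hΛ]
        simp only [← map_smul, Prod.smul_mk, smul_zero, smul_eq_mul, mul_one]
      have hf0 : f 0 = fun ζ : ℂ => T (w + ζ • ν) := by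
        funext ζ; rw [hfdef]; simp only [hz]
      have h1 : HasDerivAt (fun ζ : ℂ => w + ζ • ν) ν 0 := by
        simpa using ((hasDerivAt_id (0 : ℂ)).smul_const ν).const_add w
      have h2 : HasFDerivAt T (fderiv ℂ T w) (w + (0 : ℂ) • ν) := by
        rw [zero_smul, add_zero]; exact (hT w).hasFDerivAt
      have h3 : HasDerivAt (fun ζ : ℂ => T (w + ζ • ν)) (fderiv ℂ T w ν) 0 :=
        h2.comp_hasDerivAt (0 : ℂ) h1
      rw [hf0, h3.deriv, hTc, inner_self_eq_norm_sq_to_K, hν]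
      simpa using hc)
  refine ⟨U, fun t => w + Λ (t, γ t), ?_, fun t ht => ⟨⟨(memW _).2 (hγ t ht).1, ?_⟩, ?_⟩, ?_⟩
  · exact (hΛd.comp_differentiableOn (differentiableOn_id.prodMk hγd)).const_add w
  · rw [mem_ball, dist_eq_norm, add_sub_cancel_left]
    have h1 := hΛn (t, γ t)
    have h2 : ‖t‖ < ε := mem_ball_zero_iff.1 ht
    have h3 := (hγ t ht).2.1
    refine lt_of_pow_lt_pow_left₀ 2 (by positivity) ?_
    rw [h1]
    nlinarith [norm_nonneg t, norm_nonneg (γ t)]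
  · rw [add_sub_cancel_left, hUΛ]
  · rintro z ⟨hz1, hz2⟩
    have hzn : ‖U (z - w)‖ < ε := by rwa [U.norm_map, ← dist_eq_norm]
    have h4 : (splitFirst m (U (z - w))).2 = γ (splitFirst m (U (z - w))).1 := by
      refine (hγ _ (mem_ball_zero_iff.2 ((norm_splitFirst_fst_le _).trans_lt hzn))).2.2 _
        ((norm_splitFirst_snd_le _).trans hzn.le) ?_
      show T (w + Λ (splitFirst m (U (z - w)))) = 0
      rw [hΛU, add_sub_cancel]
      exact (memW z).1 hz2
    show w + Λ ((splitFirst m (U (z - w))).1, γ (splitFirst m (U (z - w))).1) = z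
    rw [← h4]
    show w + Λ (splitFirst m (U (z - w))) = z
    rw [hΛU, add_sub_cancel]

end GraphCoordinates

section GraphIntegrals

instance isAddHaarMeasure_vol (m : ℕ) : (vol m).IsAddHaarMeasure := by
  have h : (Module.finrank ℝ (En m) : ℝ) = 2 * m := by
    rw [finrank_real_of_complex, finrank_euclideanSpace_fin]
    push_cast
    ring
  rw [vol, ← h]
  infer_instance

/-- Integrals over balls of functions of all but one unitary coordinate. -/
theorem exists_lintegral_splitFirst_le (m : ℕ) (ε : ℝ) : ∃ K : ℝ≥0∞, K ≠ ∞ ∧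
    ∀ (U : En (m + 1) ≃ₗᵢ[ℂ] En (m + 1)) (w : En (m + 1)) (G : En m → ℝ≥0∞),
      Measurable ((ball 0 ε).indicator G) →
      ∫⁻ z in ball w ε, G (splitFirst m (U (z - w))).1 ∂vol (m + 1) ≤
        K * ∫⁻ t in ball 0 ε, G t ∂vol m := by
  set Ψ := splitFirst m
  set c := ((vol (m + 1)).map Ψ).addHaarScalarFactor ((vol m).prod (volume : Measure ℂ)) with hc
  have hΨ : (vol (m + 1)).map Ψ = c • (vol m).prod (volume : Measure ℂ) := by
    have : ((vol (m + 1)).map Ψ).IsAddHaarMeasure :=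
      (Ψ.toContinuousAddEquiv).isAddHaarMeasure_map _
    exact Measure.isAddLeftInvariant_eq_smul _ _
  refine ⟨c * volume (ball (0 : ℂ) ε), ENNReal.mul_ne_top ENNReal.coe_ne_top
    measure_ball_lt_top.ne, fun U w G hG => ?_⟩
  set e : En (m + 1) ≃ᵢ En (m + 1) := (IsometryEquiv.subRight w).trans U.toIsometryEquiv with he
  have hev : ∀ z, e z = U (z - w) := fun _ => rfl
  have hmp : MeasurePreserving e (vol (m + 1)) (vol (m + 1)) :=
    e.measurePreserving_hausdorffMeasure _
  set I : ℂ → ℝ≥0∞ := (ball 0 ε).indicator 1 with hI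
  have hIm : Measurable I := measurable_one.indicator measurableSet_ball
  set J : En m × ℂ → ℝ≥0∞ := fun a => (ball 0 ε).indicator G a.1 * I a.2 with hJ
  have hJm : Measurable J := (hG.comp measurable_fst).mul (hIm.comp measurable_snd)
  calc ∫⁻ z in ball w ε, G (Ψ (U (z - w))).1 ∂vol (m + 1)
      = ∫⁻ z in ball w ε, J (Ψ (e z)) ∂vol (m + 1) := by
        refine setLIntegral_congr_fun measurableSet_ball fun z hz => ?_
        have h1 : ‖U (z - w)‖ < ε := by rwa [U.norm_map, ← dist_eq_norm]
        have h2 : (Ψ (U (z - w))).1 ∈ ball 0 ε :=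
          mem_ball_zero_iff.2 ((norm_splitFirst_fst_le _).trans_lt h1)
        have h3 : (Ψ (U (z - w))).2 ∈ ball 0 ε :=
          mem_ball_zero_iff.2 ((norm_splitFirst_snd_le _).trans_lt h1)
        simp only [hJ, hI, hev, indicator_of_mem h2, indicator_of_mem h3, Pi.one_apply, mul_one]
    _ ≤ ∫⁻ z, J (Ψ (e z)) ∂vol (m + 1) := setLIntegral_le_lintegral _ _
    _ = ∫⁻ y, J (Ψ y) ∂vol (m + 1) :=
        hmp.lintegral_comp (f := fun y => J (Ψ y)) (hJm.comp Ψ.continuous.measurable)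
    _ = ∫⁻ a, J a ∂(vol (m + 1)).map Ψ := (lintegral_map hJm Ψ.continuous.measurable).symm
    _ = c * ((∫⁻ t, (ball 0 ε).indicator G t ∂vol m) * ∫⁻ ζ, I ζ) := by
        rw [hΨ, lintegral_smul_measure, lintegral_prod_mul hG.aemeasurable hIm.aemeasurable]
        rfl
    _ = _ := by
        rw [hI, lintegral_indicator_one measurableSet_ball, lintegral_indicator measurableSet_ball]
        ring

/-- Integrals over the base of a graph are bounded by integrals over the graph. -/
theorem lintegral_comp_le_lintegral_surf {m : ℕ} {W S : Set (En (m + 1))} (hSW : S ⊆ W)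
    {q : En (m + 1) → En m} (hq : LipschitzWith 1 q) {B : Set (En m)} (hB : MeasurableSet B)
    {x : En m → En (m + 1)} (hx : ContinuousOn x B) (hxS : MapsTo x B S)
    (hqx : ∀ t ∈ B, q (x t) = t) {H : En (m + 1) → ℝ≥0∞}
    (hH : Measurable (B.indicator (H ∘ x))) :
    ∫⁻ t in B, H (x t) ∂vol m ≤ ∫⁻ z in S, H z ∂surf (m + 1) W := by
  have hinj : InjOn x B := fun s hs t ht h => by rw [← hqx s hs, ← hqx t ht, h]
  have hA : MeasurableSet (x '' B) := hB.image_of_continuousOn_injOn hx hinj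
  set μ : Measure (En (m + 1)) := μH[(2 * m : ℝ)] with hμ
  have hle : (vol m).restrict B ≤ (μ.restrict (x '' B)).map q := by
    refine Measure.le_iff.2 fun s hs => ?_
    rw [Measure.restrict_apply hs, Measure.map_apply hq.continuous.measurable hs,
      Measure.restrict_apply (hq.continuous.measurable hs)]
    have himg : s ∩ B ⊆ q '' (q ⁻¹' s ∩ x '' B) := fun t ht =>
      ⟨x t, ⟨by rw [mem_preimage, hqx t ht.2]; exact ht.1, mem_image_of_mem x ht.2⟩, hqx t ht.2⟩
    have h := hq.hausdorffMeasure_image_le (d := 2 * m) (by positivity) (q ⁻¹' s ∩ x '' B)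
    rw [ENNReal.coe_one, ENNReal.one_rpow, one_mul] at h
    exact (measure_mono himg).trans h
  have hsurf : μ.restrict S ≤ (surf (m + 1) W).restrict S := by
    rw [surf, Measure.restrict_smul, Measure.restrict_restrict_of_subset hSW]
    have e : (2 * ((m + 1 : ℕ) : ℝ) - 2) = 2 * m := by push_cast; ring
    rw [e, ← hμ, Nat.add_sub_cancel]
    have h1 : (1 : ℝ≥0∞) ≤ 2 ^ m * (m.factorial : ℝ≥0∞) := by
      exact_mod_cast Nat.one_le_iff_ne_zero.2
        (mul_ne_zero (pow_ne_zero m two_ne_zero) m.factorial_ne_zero)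
    refine Measure.le_iff.2 fun s _ => ?_
    rw [Measure.smul_apply, smul_eq_mul]
    exact le_mul_of_one_le_left zero_le h1
  calc ∫⁻ t in B, H (x t) ∂vol m
      = ∫⁻ t in B, B.indicator (H ∘ x) t ∂vol m :=
        setLIntegral_congr_fun hB fun t ht => by simp [indicator_of_mem ht]
    _ ≤ ∫⁻ t, B.indicator (H ∘ x) t ∂(μ.restrict (x '' B)).map q := lintegral_mono' hle le_rfl
    _ = ∫⁻ z in x '' B, B.indicator (H ∘ x) (q z) ∂μ := lintegral_map hH hq.continuous.measurable
    _ = ∫⁻ z in x '' B, H z ∂μ := by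
        refine setLIntegral_congr_fun hA ?_
        rintro _ ⟨t, ht, rfl⟩
        simp [hqx t ht, indicator_of_mem ht]
    _ ≤ ∫⁻ z in S, H z ∂μ := lintegral_mono_set hxS.image_subset
    _ ≤ _ := lintegral_mono' hsurf le_rfl

end GraphIntegrals

section LocalExtension

/-- The composition of a holomorphic function on a piece of a hypersurface with a holomorphic
parametrization is holomorphic. -/
theorem HolOnPiece.differentiableOn_comp {n m : ℕ} {W S : Set (En n)} {f : En n → ℂ}
    (hf : HolOnPiece W S f) {B : Set (En m)} (hB : IsOpen B) {x : En m → En n}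
    (hx : DifferentiableOn ℂ x B) (hxS : MapsTo x B (S ∩ W)) :
    DifferentiableOn ℂ (f ∘ x) B := by
  intro t ht
  obtain ⟨U, hU, g, hg, hfg⟩ := hf (x t) (hxS ht)
  have hxt : DifferentiableAt ℂ x t := hx.differentiableAt (hB.mem_nhds ht)
  have hgx : DifferentiableAt ℂ (g ∘ x) t := (hg.differentiableAt hU).comp t hxt
  refine (hgx.congr_of_eventuallyEq ?_).differentiableWithinAt
  filter_upwards [hxt.continuousAt hU, hB.mem_nhds ht] with s hs1 hs2
  exact hfg ⟨hs1, hxS hs2⟩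

/-- The quantity integrated in the weighted `L^p` norm is a `p`-th power. -/
theorem rpow_mul_exp_neg {a p s : ℝ} (ha : 0 ≤ a) :
    a ^ p * Real.exp (-(p * s)) = (a * Real.exp (-s)) ^ p := by
  rw [Real.mul_rpow ha (Real.exp_pos _).le, ← Real.exp_mul]
  ring_nf

theorem measurable_indicator_of_continuousOn {α β : Type*} [TopologicalSpace α]
    [MeasurableSpace α] [OpensMeasurableSpace α] [TopologicalSpace β] [MeasurableSpace β]
    [BorelSpace β] [Zero β] {s : Set α} (hs : MeasurableSet s) {f : α → β}
    (hf : ContinuousOn f s) : Measurable (s.indicator f) := by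
  classical
  rw [← piecewise_eq_indicator]
  exact hf.measurable_piecewise continuousOn_const hs

/-- A pointwise bound by the values of a function along a graph gives a bound of weighted norms. -/
theorem exists_wNorm_le_of_graph (m : ℕ) (ε c : ℝ) (p : ℝ≥0∞) : ∃ C > (0 : ℝ),
    ∀ {W : Set (En (m + 1))} {w : En (m + 1)} {φ : En (m + 1) → ℝ} {f F : En (m + 1) → ℂ}
      {U : En (m + 1) ≃ₗᵢ[ℂ] En (m + 1)} {x : En m → En (m + 1)},
      Continuous φ → ContinuousOn x (ball 0 ε) → ContinuousOn (f ∘ x) (ball 0 ε) →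
      (∀ t ∈ ball (0 : En m) ε, x t ∈ W ∩ ball w (2 * ε) ∧
        (splitFirst m (U (x t - w))).1 = t) →
      (∀ z ∈ ball w ε, ‖F z‖ * Real.exp (-φ z) ≤
        Real.exp c * (‖f (x (splitFirst m (U (z - w))).1)‖ *
          Real.exp (-φ (x (splitFirst m (U (z - w))).1)))) →
      wNorm p φ (vol (m + 1)) (ball w ε) F ≤
        ENNReal.ofReal C * wNorm p φ (surf (m + 1) W) (W ∩ ball w (2 * ε)) f := by
  have hmem : ∀ {w z : En (m + 1)} (U : En (m + 1) ≃ₗᵢ[ℂ] En (m + 1)), z ∈ ball w ε →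
      (splitFirst m (U (z - w))).1 ∈ ball 0 ε := fun U hz => by
    refine mem_ball_zero_iff.2 ((norm_splitFirst_fst_le _).trans_lt ?_)
    rwa [U.norm_map, ← dist_eq_norm]
  by_cases hp : p = ∞
  · refine ⟨Real.exp c, Real.exp_pos c, fun {W w φ f F U x} _ _ _ hxW hF => ?_⟩
    simp only [wNorm, hp, if_true]
    refine iSup₂_le fun z hz => ?_
    refine (ENNReal.ofReal_le_ofReal (hF z hz)).trans ?_
    rw [ENNReal.ofReal_mul (Real.exp_pos c).le]
    gcongr
    exact le_iSup₂ (f := fun z (_ : z ∈ W ∩ ball w (2 * ε)) =>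
      ENNReal.ofReal (‖f z‖ * Real.exp (-φ z))) _ (hxW _ (hmem U hz)).1
  obtain ⟨K, hK, hKle⟩ := exists_lintegral_splitFirst_le m ε
  set P := p.toReal with hP
  have hP0 : 0 ≤ P := ENNReal.toReal_nonneg
  refine ⟨Real.exp c ^ P * (K.toReal + 1), by positivity,
    fun {W w φ f F U x} hφ hxc hfx hxW hF => ?_⟩
  simp only [wNorm, hp, if_false]
  set H : En (m + 1) → ℝ≥0∞ := fun z =>
    ENNReal.ofReal (‖f z‖ ^ P * Real.exp (-(P * φ z))) with hH
  have hHx : Measurable ((ball 0 ε).indicator (H ∘ x)) := by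
    refine measurable_indicator_of_continuousOn measurableSet_ball ?_
    refine ENNReal.continuous_ofReal.comp_continuousOn ?_
    refine (hfx.norm.rpow_const fun _ _ => Or.inr hP0).mul ?_
    exact Real.continuous_exp.comp_continuousOn
      (continuousOn_const.mul (hφ.comp_continuousOn hxc)).neg
  have hq : LipschitzWith 1 fun z => (splitFirst m (U (z - w))).1 :=
    LipschitzWith.of_dist_le_mul fun y z => by
      rw [NNReal.coe_one, one_mul, dist_eq_norm, dist_eq_norm, ← Prod.fst_sub, ← map_sub,
        ← map_sub, sub_sub_sub_cancel_right, ← U.norm_map (y - z)]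
      exact norm_splitFirst_fst_le _
  have hsurf := lintegral_comp_le_lintegral_surf (W := W) (S := W ∩ ball w (2 * ε))
    inter_subset_left hq measurableSet_ball hxc (fun t ht => (hxW t ht).1)
    (fun t ht => (hxW t ht).2) hHx
  calc ∫⁻ z in ball w ε, ENNReal.ofReal (‖F z‖ ^ P * Real.exp (-(P * φ z))) ∂vol (m + 1)
      ≤ ∫⁻ z in ball w ε, ENNReal.ofReal (Real.exp c ^ P) *
          (H ∘ x) (splitFirst m (U (z - w))).1 ∂vol (m + 1) := by
        refine setLIntegral_mono' measurableSet_ball fun z hz => ?_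
        rw [Function.comp_apply, hH, ← ENNReal.ofReal_mul (by positivity)]
        refine ENNReal.ofReal_le_ofReal ?_
        rw [rpow_mul_exp_neg (norm_nonneg _), rpow_mul_exp_neg (norm_nonneg _),
          ← Real.mul_rpow (Real.exp_pos c).le (by positivity)]
        exact Real.rpow_le_rpow (by positivity) (hF z hz) hP0
    _ = ENNReal.ofReal (Real.exp c ^ P) *
          ∫⁻ z in ball w ε, (H ∘ x) (splitFirst m (U (z - w))).1 ∂vol (m + 1) :=
        lintegral_const_mul' _ _ ENNReal.ofReal_ne_top
    _ ≤ ENNReal.ofReal (Real.exp c ^ P) * (K * ∫⁻ t in ball 0 ε, (H ∘ x) t ∂vol m) := by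
        gcongr
        exact hKle U w (H ∘ x) hHx
    _ ≤ ENNReal.ofReal (Real.exp c ^ P) * (ENNReal.ofReal (K.toReal + 1) *
          ∫⁻ z in W ∩ ball w (2 * ε), H z ∂surf (m + 1) W) := by
        gcongr
        · rw [← ENNReal.ofReal_toReal hK]
          exact ENNReal.ofReal_le_ofReal (by simp)
        · exact hsurf
    _ = _ := by rw [ENNReal.ofReal_mul (by positivity), mul_assoc]

end LocalExtension

/-- **Lemma (local extension with uniform `L^p` bounds).**  Let `W = T⁻¹(0)` be
uniformly flat with tubular radius `ε₀`, let `0 < ε < ε₀/2`, `0 < p ≤ ∞` and let `φ` be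
`C²` plurisubharmonic with `i∂∂̄φ ≤ Mω`.  There is `C > 0`, depending only on
`ε₀, ε, p, M`, such that every `f` holomorphic on `B(w,2ε) ∩ W` (`w ∈ W`) admits a
holomorphic extension `F` to `B(w,ε)` with
`‖F‖^p_{L^p(B(w,ε))} ≤ C ‖f‖^p_{L^p(W ∩ B(w,2ε))}` (suprema when `p = ∞`). -/
theorem local_extension_near_hypersurface
    (n : ℕ) (ε₀ ε : ℝ) (hε : 0 < ε) (hεε₀ : ε < ε₀ / 2)
    (p : ℝ≥0∞) (hp : 0 < p) (M : ℝ) (hM : 0 < M) :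
    ∃ C > (0 : ℝ), ∀ (T : En n → ℂ) (W : Set (En n)) (φ : En n → ℝ),
      Differentiable ℂ T → W = T ⁻¹' {0} → (∀ z ∈ W, fderiv ℂ T z ≠ 0) →
      UniformlyFlatWith ε₀ W →
      ContDiff ℝ 2 φ → (∀ z v : En n, 0 ≤ levi φ z v) →
      (∀ z v : En n, levi φ z v ≤ M * ‖v‖ ^ 2) →
      ∀ w ∈ W, ∀ f : En n → ℂ, HolOnPiece W (Metric.ball w (2 * ε)) f →
        ∃ F : En n → ℂ, DifferentiableOn ℂ F (Metric.ball w ε) ∧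
          (∀ z ∈ Metric.ball w ε ∩ W, F z = f z) ∧
          wNorm p φ (vol n) (Metric.ball w ε) F ≤
            ENNReal.ofReal C * wNorm p φ (surf n W) (W ∩ Metric.ball w (2 * ε)) f := by
  rcases n with _ | m
  · refine ⟨1, one_pos, fun T W φ _ _ hdT _ _ _ _ w hw => absurd ?_ (hdT w hw)⟩
    ext v
    rw [Subsingleton.elim v 0, map_zero, map_zero]
  obtain ⟨c, -, hc⟩ := exists_differentiableOn_abs_sub_re_le (m + 1) (M := M) (r := 2 * ε)
    (by positivity) hM.le
  obtain ⟨C, hC, hCle⟩ := exists_wNorm_le_of_graph m ε (2 * c) p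
  refine ⟨C, hC, fun T W φ hT hW hdT hflat hφ hφ0 hφM w hw f hf => ?_⟩
  obtain ⟨g, hg, hφg⟩ := hc φ hφ hφ0 hφM w
  obtain ⟨U, x, hx, hxW, hxz⟩ := exists_graph_coordinates hT hW hflat hw (hdT w hw) hε hεε₀
  have hball : ball w ε ⊆ ball w (2 * ε) := ball_subset_ball (by linarith)
  have hfx : DifferentiableOn ℂ (f ∘ x) (ball 0 ε) :=
    hf.differentiableOn_comp isOpen_ball hx fun t ht => (hxW t ht).1.symm
  have hgx : DifferentiableOn ℂ (g ∘ x) (ball 0 ε) := hg.comp hx fun t ht => (hxW t ht).1.2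
  set q : En (m + 1) → En m := fun z => (splitFirst m (U (z - w))).1 with hq
  have hqd : Differentiable ℂ q :=
    (((splitFirst m).differentiable.comp U.toContinuousLinearEquiv.differentiable).comp
      (differentiable_id.sub_const w)).fst
  have hqB : MapsTo q (ball w ε) (ball 0 ε) := fun z hz => by
    refine mem_ball_zero_iff.2 ((norm_splitFirst_fst_le _).trans_lt ?_)
    rwa [U.norm_map, ← dist_eq_norm]
  refine ⟨fun z => f (x (q z)) * Complex.exp (g z - g (x (q z))), ?_, ?_, ?_⟩
  · exact (hfx.comp hqd.differentiableOn hqB).mul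
      ((hg.mono hball).sub (hgx.comp hqd.differentiableOn hqB)).cexp
  · intro z hz
    have h : x (q z) = z := hxz z hz
    simp [h]
  · refine hCle hφ.continuous hx.continuousOn hfx.continuousOn hxW fun z hz => ?_
    have h1 := abs_le.1 (hφg z (hball hz))
    have h2 := abs_le.1 (hφg _ (hxW _ (hqB hz)).1.2)
    rw [norm_mul, Complex.norm_exp, Complex.sub_re, mul_assoc, mul_left_comm (Real.exp (2 * c)),
      ← Real.exp_add, ← Real.exp_add]
    refine mul_le_mul_of_nonneg_left (Real.exp_le_exp.2 ?_) (norm_nonneg _)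
    linarith
end
end

section
/- For every c ∈ (0,1] there exists a constant C > 0, depending only on c, with the following property: for every C² function φ on the unit disk 𝔻 ⊂ ℂ satisfying c ≤ Δφ ≤ 1/c on 𝔻 there is a holomorphic function H on 𝔻 such that H(0) = 0 and |Re H(z) − φ(z) + φ(0)| ≤ C for all z ∈ 𝔻. -/
open MeasureTheory Metric Set
open scoped ENNReal Topology

noncomputable section

/-- The Laplacian `Δφ = φ_{xx} + φ_{yy}` of a function `φ : ℂ → ℝ`, expressed through
the second (real) derivative in the directions `1` and `i`. -/
def lap (φ : ℂ → ℝ) (z : ℂ) : ℝ :=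
  fderiv ℝ (fderiv ℝ φ) z 1 1 + fderiv ℝ (fderiv ℝ φ) z Complex.I Complex.I

open Filter

open scoped Laplacian in
theorem lap_eq_laplacian (φ : ℂ → ℝ) : lap φ = Δ φ := by
  ext z
  rw [InnerProductSpace.laplacian_eq_iteratedFDeriv_complexPlane]
  simp [lap, iteratedFDeriv_two_apply]

theorem lap_add {f g : ℂ → ℝ} {z : ℂ} (hf : ContDiffAt ℝ 2 f z) (hg : ContDiffAt ℝ 2 g z) :
    lap (f + g) z = lap f z + lap g z := by
  simp only [lap_eq_laplacian]
  exact hf.laplacian_add hg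

theorem lap_neg {f : ℂ → ℝ} {z : ℂ} : lap (-f) z = -lap f z := by
  simp only [lap_eq_laplacian]
  rw [InnerProductSpace.laplacian_neg]; rfl

theorem lap_const_mul (a : ℝ) {f : ℂ → ℝ} {z : ℂ} (hf : ContDiffAt ℝ 2 f z) :
    lap (fun w => a * f w) z = a * lap f z := by
  simp only [lap_eq_laplacian]
  exact InnerProductSpace.laplacian_smul a hf

theorem lap_norm_sq (z : ℂ) : lap (fun w => ‖w‖ ^ 2) z = 4 := by
  have h : fderiv ℝ (fun w : ℂ => ‖w‖ ^ 2) = ⇑((2 : ℝ) • innerSL ℝ (E := ℂ)) := by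
    ext w : 1
    rw [fderiv_norm_sq_apply]
    simp [two_smul]
  rw [lap, h, ContinuousLinearMap.fderiv]
  change 2 * inner ℝ (1 : ℂ) 1 + 2 * inner ℝ Complex.I Complex.I = 4
  simp only [real_inner_self_eq_norm_sq, norm_one, Complex.norm_I]
  norm_num

theorem lap_re {P : ℂ → ℂ} (hP : Differentiable ℂ P) (z : ℂ) :
    lap (fun w => (P w).re) z = 0 := by
  rw [lap_eq_laplacian]
  exact (AnalyticAt.harmonicAt_re (hP.analyticAt z)).2.self_of_nhds

theorem contDiff_re_comp {P : ℂ → ℂ} (hP : Differentiable ℂ P) :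
    ContDiff ℝ 2 (fun w => (P w).re) :=
  contDiff_iff_contDiffAt.2 fun z => (AnalyticAt.harmonicAt_re (hP.analyticAt z)).1

/-- At an interior local maximum, the second derivative is nonpositive in each direction. -/
theorem IsLocalMax.fderiv_fderiv_apply_nonpos {E : Type*} [NormedAddCommGroup E] [NormedSpace ℝ E]
    {u : E → ℝ} {x : E} (h : IsLocalMax u x) (hu : ContDiffAt ℝ 2 u x) (v : E) :
    fderiv ℝ (fderiv ℝ u) x v v ≤ 0 := by
  by_contra! hpos
  set l : ℝ → E := fun t => x + t • v with hl
  have hlc : Continuous l := by fun_prop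
  have hl0 : l 0 = x := by simp [hl]
  have hld : ∀ t, HasDerivAt l v t := fun t =>
    HasDerivAt.const_add x (by simpa using (hasDerivAt_id t).smul_const v)
  have htend : Tendsto l (𝓝 0) (𝓝 x) := by simpa [hl0] using hlc.tendsto 0
  have hev : ∀ᶠ y in 𝓝 x, DifferentiableAt ℝ u y := by
    filter_upwards [hu.eventually (by simp)] with y hy using hy.differentiableAt (by simp)
  have hd1 : deriv (u ∘ l) =ᶠ[𝓝 0] fun t => fderiv ℝ u (l t) v := by
    filter_upwards [htend.eventually hev] with t ht
    exact (ht.hasFDerivAt.comp_hasDerivAt t (hld t)).deriv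
  have hdd : DifferentiableAt ℝ (fderiv ℝ u) x :=
    (hu.fderiv_right (m := 1) (by norm_num)).differentiableAt (by simp)
  have hd2 : deriv (deriv (u ∘ l)) 0 = fderiv ℝ (fderiv ℝ u) x v v := by
    rw [hd1.deriv_eq]
    have h1 : HasDerivAt (fun t => fderiv ℝ u (l t)) (fderiv ℝ (fderiv ℝ u) x v) 0 :=
      HasFDerivAt.comp_hasDerivAt (l := fderiv ℝ u) 0 (by rw [hl0]; exact hdd.hasFDerivAt) (hld 0)
    simpa using (h1.clm_apply (hasDerivAt_const 0 v)).deriv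
  have hmax : IsLocalMax (u ∘ l) 0 := by
    have := htend.eventually h
    filter_upwards [this] with t ht
    simpa [hl0] using ht
  have hmin : IsLocalMin (u ∘ l) 0 :=
    isLocalMin_of_deriv_deriv_pos (by rw [hd2]; exact hpos) hmax.deriv_eq_zero
      (ContinuousAt.comp (by rw [hl0]; exact hu.continuousAt) hlc.continuousAt)
  have hconst : u ∘ l =ᶠ[𝓝 0] fun _ => (u ∘ l) 0 := by
    filter_upwards [hmax, hmin] with t h1 h2 using le_antisymm h1 h2
  have : deriv (deriv (u ∘ l)) 0 = 0 := by
    rw [hconst.deriv.deriv_eq]; simp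
  linarith

/-- The weak maximum principle for twice differentiable subharmonic functions on a disk. -/
theorem le_of_lap_nonneg {u : ℂ → ℝ} {r m : ℝ} (hcont : ContinuousOn u (closedBall 0 r))
    (hu : ∀ z ∈ ball (0 : ℂ) r, ContDiffAt ℝ 2 u z) (hlap : ∀ z ∈ ball (0 : ℂ) r, 0 ≤ lap u z)
    (hm : ∀ z ∈ sphere (0 : ℂ) r, u z ≤ m) {z : ℂ} (hz : z ∈ ball (0 : ℂ) r) : u z ≤ m := by
  refine le_of_forall_pos_le_add fun δ hδ => ?_
  have hr : 0 < r := pos_of_mem_ball hz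
  set ε := δ / r ^ 2 with hε
  have hε0 : 0 < ε := by positivity
  have hsq : ContDiff ℝ 2 fun w : ℂ => ‖w‖ ^ 2 := contDiff_norm_sq ℝ
  set w : ℂ → ℝ := u + fun z => ε * ‖z‖ ^ 2 with hw
  have hwc : ContinuousOn w (closedBall 0 r) := hcont.add (by fun_prop)
  obtain ⟨x, hx, hmax⟩ := (isCompact_closedBall (0 : ℂ) r).exists_isMaxOn
    ⟨z, ball_subset_closedBall hz⟩ hwc
  have hxs : x ∈ sphere (0 : ℂ) r := by
    by_contra hxs
    have hxb : x ∈ ball (0 : ℂ) r := by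
      rw [← ball_union_sphere] at hx
      exact hx.resolve_right hxs
    have hloc : IsLocalMax w x :=
      (hmax.on_subset ball_subset_closedBall).isLocalMax (isOpen_ball.mem_nhds hxb)
    have hεc : ContDiffAt ℝ 2 (fun z : ℂ => ε * ‖z‖ ^ 2) x := (contDiff_const.mul hsq).contDiffAt
    have hwd : ContDiffAt ℝ 2 w x := (hu x hxb).add hεc
    have h1 : lap w x ≤ 0 := add_nonpos (hloc.fderiv_fderiv_apply_nonpos hwd _)
      (hloc.fderiv_fderiv_apply_nonpos hwd _)
    rw [hw, lap_add (hu x hxb) hεc, lap_const_mul ε hsq.contDiffAt, lap_norm_sq] at h1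
    linarith [hlap x hxb]
  have h1 : w z ≤ w x := hmax (ball_subset_closedBall hz)
  have h2 := hm x hxs
  have h3 : ‖x‖ = r := by simpa using hxs
  have h4 : ε * r ^ 2 = δ := by rw [hε]; field_simp
  simp only [hw, Pi.add_apply, h3, h4] at h1
  nlinarith [mul_nonneg hε0.le (sq_nonneg ‖z‖)]

/-- Every continuous real function on a circle is a uniform limit of real parts of entire
functions. -/
theorem exists_differentiable_re_approx_on_sphere {f : ℂ → ℝ} {r ε : ℝ} (hr : 0 < r)
    (hf : ContinuousOn f (sphere 0 r)) (hε : 0 < ε) :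
    ∃ P : ℂ → ℂ, Differentiable ℂ P ∧ ∀ z ∈ sphere (0 : ℂ) r, |(P z).re - f z| ≤ ε := by
  have : Fact ((0 : ℝ) < 1) := ⟨one_pos⟩
  let e : AddCircle (1 : ℝ) → ℂ := fun t => r * AddCircle.toCircle t
  have he : ∀ t, e t ∈ sphere (0 : ℂ) r := fun t => by
    rw [mem_sphere_zero_iff_norm, norm_mul, Circle.norm_coe, mul_one, Complex.norm_real,
      Real.norm_of_nonneg hr.le]
  have hec : Continuous e := by
    have := AddCircle.continuous_toCircle (T := (1 : ℝ))
    fun_prop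
  let F : C(AddCircle (1 : ℝ), ℂ) :=
    ⟨fun t => (f (e t) : ℂ), Complex.continuous_ofReal.comp (hf.comp_continuous hec he)⟩
  have hspan : ∀ g ∈ Submodule.span ℂ (range (@fourier (1 : ℝ))), ∀ a : ℂ,
      ∃ P : ℂ → ℂ, Differentiable ℂ P ∧ ∀ t, (P (e t)).re = (a * g t).re := by
    intro g hg
    induction hg using Submodule.span_induction with
    | mem g hg =>
      obtain ⟨n, rfl⟩ := hg
      intro a
      have hrc : (r : ℂ) ≠ 0 := by exact_mod_cast hr.ne'
      obtain ⟨k, rfl | rfl⟩ := n.eq_nat_or_neg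
      · refine ⟨fun z => a * (z / r) ^ k, by fun_prop, fun t => ?_⟩
        simp only [e, fourier_apply, AddCircle.toCircle_zsmul]
        rw [mul_div_cancel_left₀ _ hrc]
        simp
      · refine ⟨fun z => starRingEnd ℂ a * (z / r) ^ k, by fun_prop, fun t => ?_⟩
        simp only [e, fourier_apply, AddCircle.toCircle_zsmul]
        rw [mul_div_cancel_left₀ _ hrc, ← Complex.conj_re]
        simp [← Circle.coe_inv_eq_conj]
    | zero => exact fun a => ⟨fun _ => 0, by fun_prop, by simp⟩
    | add g₁ g₂ _ _ h₁ h₂ =>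
      intro a
      obtain ⟨P₁, hP₁, h₁⟩ := h₁ a
      obtain ⟨P₂, hP₂, h₂⟩ := h₂ a
      exact ⟨P₁ + P₂, hP₁.add hP₂, fun t => by
        simp only [Pi.add_apply, Complex.add_re, h₁, h₂, ContinuousMap.add_apply, mul_add]⟩
    | smul b g _ h =>
      intro a
      obtain ⟨P, hP, h⟩ := h (a * b)
      exact ⟨P, hP, fun t => by rw [h, ContinuousMap.smul_apply, smul_eq_mul, mul_assoc]⟩
  have hF : F ∈ closure (Submodule.span ℂ (range (@fourier (1 : ℝ))) : Set _) := by
    rw [← Submodule.topologicalClosure_coe, span_fourier_closure_eq_top]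
    trivial
  obtain ⟨g, hg, hgF⟩ := Metric.mem_closure_iff.1 hF ε hε
  obtain ⟨P, hP, hPg⟩ := hspan g hg 1
  refine ⟨P, hP, fun z hz => ?_⟩
  obtain ⟨t, rfl⟩ : ∃ t, e t = z := by
    have hz' : ‖z‖ = r := by simpa using hz
    let w : Circle := ⟨z / r, by
      rw [← SetLike.mem_coe, Submonoid.coe_unitSphere, mem_sphere_zero_iff_norm, norm_div, hz', Complex.norm_real, Real.norm_of_nonneg hr.le,
        div_self hr.ne']⟩
    refine ⟨(AddCircle.homeomorphCircle one_ne_zero).symm w, ?_⟩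
    have hrc : (r : ℂ) ≠ 0 := by exact_mod_cast hr.ne'
    simp only [e, ← AddCircle.homeomorphCircle_apply (one_ne_zero), Homeomorph.apply_symm_apply]
    simp [w, mul_div_cancel₀ _ hrc]
  have h1 : dist (F t) (g t) < ε := (ContinuousMap.dist_apply_le_dist t).trans_lt hgF
  rw [hPg, one_mul]
  have h2 : (g t).re - f (e t) = (g t - F t).re := by simp [F]
  rw [h2]
  rw [dist_comm, dist_eq_norm] at h1
  exact (Complex.abs_re_le_norm _).trans h1.le

/-- Quadratic Taylor estimate for a bounded holomorphic function on a disk. -/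
theorem norm_sub_sub_deriv_le {f : ℂ → ℂ} {z₀ z : ℂ} {δ M : ℝ} (hδ : 0 < δ)
    (hf : DifferentiableOn ℂ f (ball z₀ δ)) (hM : ∀ w ∈ ball z₀ δ, ‖f w‖ ≤ M)
    (hz : z ∈ ball z₀ δ) :
    ‖f z - f z₀ - (z - z₀) * deriv f z₀‖ ≤ 4 * M / δ ^ 2 * ‖z - z₀‖ ^ 2 := by
  have hz₀ := mem_ball_self (x := z₀) hδ
  set g := dslope f z₀
  have hg : DifferentiableOn ℂ g (ball z₀ δ) :=
    (Complex.differentiableOn_dslope (isOpen_ball.mem_nhds hz₀)).2 hf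
  have hgb : ∀ w ∈ ball z₀ δ, ‖g w‖ ≤ 2 * M / δ := fun w hw =>
    Complex.norm_dslope_le_div_of_mapsTo_ball hf (fun y hy => by
      rw [mem_closedBall, dist_eq_norm]
      linarith [norm_sub_le (f y) (f z₀), hM y hy, hM z₀ hz₀]) hw
  have hgg : ‖dslope g z₀ z‖ ≤ (2 * (2 * M / δ)) / δ :=
    Complex.norm_dslope_le_div_of_mapsTo_ball hg (fun y hy => by
      rw [mem_closedBall, dist_eq_norm]
      linarith [norm_sub_le (g y) (g z₀), hgb y hy, hgb z₀ hz₀]) hz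
  have h1 : f z - f z₀ - (z - z₀) * deriv f z₀ = (z - z₀) ^ 2 * dslope g z₀ z := by
    have e1 : (z - z₀) * g z = f z - f z₀ := sub_smul_dslope f z₀ z
    have e2 : (z - z₀) * dslope g z₀ z = g z - g z₀ := sub_smul_dslope g z₀ z
    have e3 : g z₀ = deriv f z₀ := dslope_same f z₀
    rw [← e1, ← e3]
    linear_combination -(z - z₀) * e2
  rw [h1, norm_mul, norm_pow]
  calc ‖z - z₀‖ ^ 2 * ‖dslope g z₀ z‖ ≤ ‖z - z₀‖ ^ 2 * ((2 * (2 * M / δ)) / δ) := by gcongr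
    _ = 4 * M / δ ^ 2 * ‖z - z₀‖ ^ 2 := by field_simp; ring

/-- A form of Montel's theorem: a sequence of entire functions which is eventually bounded near
every point of `U` has a holomorphic limit on `U` along any ultrafilter finer than `atTop`. -/
theorem exists_differentiableOn_ultrafilter_limit {U : Set ℂ} {P : ℕ → ℂ → ℂ} (l : Ultrafilter ℕ)
    (hP : ∀ n, Differentiable ℂ (P n))
    (hb : ∀ z₀ ∈ U, ∃ δ > 0, ∃ M, ∀ᶠ n in l, ∀ z ∈ ball z₀ δ, ‖P n z‖ ≤ M) :
    ∃ G : ℂ → ℂ, DifferentiableOn ℂ G U ∧ ∀ z ∈ U, Tendsto (P · z) l (𝓝 (G z)) := by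
  have hlim : ∀ (a : ℕ → ℂ) (M : ℝ), (∀ᶠ n in l, ‖a n‖ ≤ M) → ∃ b, Tendsto a l (𝓝 b) := by
    intro a M h
    obtain ⟨b, -, hb⟩ := (isCompact_closedBall (0 : ℂ) M).ultrafilter_le_nhds (l.map a) <|
      le_principal_iff.2 <| mem_map.2 <| h.mono fun n hn => mem_closedBall_zero_iff.2 hn
    exact ⟨b, hb⟩
  let G : ℂ → ℂ := fun z => limUnder (l : Filter ℕ) (P · z)
  have hG : ∀ z, (∃ M, ∀ᶠ n in l, ‖P n z‖ ≤ M) → Tendsto (P · z) l (𝓝 (G z)) := fun z ⟨M, hM⟩ =>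
    tendsto_nhds_limUnder (hlim _ M hM)
  refine ⟨G, fun z₀ hz₀ => ?_, fun z hz => ?_⟩
  · obtain ⟨δ, hδ, M, hM⟩ := hb z₀ hz₀
    have hGz : ∀ z ∈ ball z₀ δ, Tendsto (P · z) l (𝓝 (G z)) := fun z hz =>
      hG z ⟨M, hM.mono fun n h => h z hz⟩
    obtain ⟨L, hL⟩ := hlim (fun n => deriv (P n) z₀) (2 * M / δ) <| hM.mono fun n h =>
      Complex.norm_deriv_le_div_of_mapsTo_ball (hP n).differentiableOn (fun y hy => by
        rw [mem_closedBall, dist_eq_norm]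
        linarith [norm_sub_le (P n y) (P n z₀), h y hy, h z₀ (mem_ball_self hδ)]) hδ
    have hest : ∀ z ∈ ball z₀ δ,
        ‖G z - G z₀ - (z - z₀) * L‖ ≤ 4 * M / δ ^ 2 * ‖z - z₀‖ ^ 2 := fun z hz =>
      le_of_tendsto (((hGz z hz).sub (hGz z₀ (mem_ball_self hδ))).sub
        (hL.const_mul (z - z₀))).norm <| hM.mono fun n h =>
          norm_sub_sub_deriv_le hδ (hP n).differentiableOn h hz
    have hder : HasDerivAt G L z₀ := by
      rw [hasDerivAt_iff_isLittleO]
      have h1 : (fun z => G z - G z₀ - (z - z₀) • L) =O[𝓝 z₀] fun z => ‖z - z₀‖ ^ 2 :=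
        Asymptotics.IsBigO.of_bound (4 * M / δ ^ 2) <| by
          filter_upwards [ball_mem_nhds z₀ hδ] with z hz
          simpa using hest z hz
      refine h1.trans_isLittleO ?_
      have := Asymptotics.isLittleO_norm_pow_id (E' := ℂ) one_lt_two
      refine (this.comp_tendsto (k := fun z => z - z₀) (l' := 𝓝 z₀) ?_)
      exact tendsto_sub_nhds_zero_iff.2 tendsto_id
    exact hder.differentiableAt.differentiableWithinAt
  · obtain ⟨δ, hδ, M, hM⟩ := hb z hz
    exact hG z ⟨M, hM.mono fun n h => h z (mem_ball_self hδ)⟩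

/-- On smaller disks a weight is within bounded distance of the real part of an entire function. -/
theorem exists_differentiable_re_approx_on_ball {c : ℝ} (hc0 : 0 < c) (hc1 : c ≤ 1) {φ : ℂ → ℝ}
    (hφ : ContDiffOn ℝ 2 φ (ball 0 1))
    (hlap : ∀ z ∈ ball (0 : ℂ) 1, c ≤ lap φ z ∧ lap φ z ≤ 1 / c) {r : ℝ} (hr0 : 0 < r)
    (hr1 : r < 1) :
    ∃ P : ℂ → ℂ, Differentiable ℂ P ∧ ∀ z ∈ ball (0 : ℂ) r, |(P z).re - φ z| ≤ 1 / c := by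
  have hsub : closedBall (0 : ℂ) r ⊆ ball 0 1 := closedBall_subset_ball hr1
  have hcont : ContinuousOn φ (closedBall 0 r) := hφ.continuousOn.mono hsub
  have hφat : ∀ z ∈ ball (0 : ℂ) r, ContDiffAt ℝ 2 φ z := fun z hz =>
    hφ.contDiffAt (isOpen_ball.mem_nhds (hsub (ball_subset_closedBall hz)))
  obtain ⟨P, hP, hPφ⟩ := exists_differentiable_re_approx_on_sphere hr0
    (hcont.mono sphere_subset_closedBall) (show (0 : ℝ) < 1 / 4 by norm_num)
  have hPd := contDiff_re_comp hP
  have hc : 1 ≤ 1 / c := by rw [le_div_iff₀ hc0]; linarith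
  have hsq : ContDiff ℝ 2 fun w : ℂ => ‖w‖ ^ 2 := contDiff_norm_sq ℝ
  refine ⟨P, hP, fun z hz => abs_le.2 ⟨?_, ?_⟩⟩
  · have h := le_of_lap_nonneg (u := φ + -fun w => (P w).re) (m := 1 / 4)
      (hcont.add hPd.continuous.continuousOn.neg)
      (fun w hw => (hφat w hw).add hPd.contDiffAt.neg)
      (fun w hw => by
        have hd : ContDiffAt ℝ 2 (-fun w => (P w).re) w := hPd.contDiffAt.neg
        rw [lap_add (hφat w hw) hd, lap_neg, lap_re hP]
        linarith [(hlap w (hsub (ball_subset_closedBall hw))).1])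
      (fun w hw => by
        simp only [Pi.add_apply, Pi.neg_apply]
        linarith [(abs_le.1 (hPφ w hw)).1]) hz
    simp only [Pi.add_apply, Pi.neg_apply] at h
    linarith
  · have hqd : ContDiff ℝ 2 fun w : ℂ => 1 / (4 * c) * ‖w‖ ^ 2 := contDiff_const.mul hsq
    have h4 : 1 / (4 * c) = 1 / c / 4 := by field_simp
    have h := le_of_lap_nonneg
      (u := (fun w => (P w).re) + (-φ + fun w => 1 / (4 * c) * ‖w‖ ^ 2))
      (m := 1 / 4 + 1 / (4 * c))
      (hPd.continuous.continuousOn.add (hcont.neg.add hqd.continuous.continuousOn))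
      (fun w hw => hPd.contDiffAt.add ((hφat w hw).neg.add hqd.contDiffAt))
      (fun w hw => by
        have hd₁ : ContDiffAt ℝ 2 (-φ) w := (hφat w hw).neg
        have hd₂ : ContDiffAt ℝ 2 (-φ + fun w => 1 / (4 * c) * ‖w‖ ^ 2) w :=
          hd₁.add hqd.contDiffAt
        rw [lap_add hPd.contDiffAt hd₂, lap_re hP, lap_add hd₁ hqd.contDiffAt, lap_neg,
          lap_const_mul _ hsq.contDiffAt, lap_norm_sq, h4]
        linarith [(hlap w (hsub (ball_subset_closedBall hw))).2])
      (fun w hw => by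
        have hw' : ‖w‖ = r := by simpa using hw
        have : r ^ 2 ≤ 1 := by nlinarith
        simp only [Pi.add_apply, Pi.neg_apply, hw', h4]
        nlinarith [(abs_le.1 (hPφ w hw)).2]) hz
    simp only [Pi.add_apply, Pi.neg_apply] at h
    have : 0 ≤ 1 / (4 * c) * ‖z‖ ^ 2 := by positivity
    linarith

/-- **Lemma (holomorphic atom for a weight on the disk).**  For every `c ∈ (0,1]` there
is `C > 0`, depending only on `c`, such that every `C²` function `φ` on the unit disk
with `c ≤ Δφ ≤ 1/c` admits a holomorphic `H` with `H(0) = 0` and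
`|Re H - φ + φ(0)| ≤ C` on the disk. -/
theorem holomorphic_approximation_of_weight (c : ℝ) (hc0 : 0 < c) (hc1 : c ≤ 1) :
    ∃ C > (0 : ℝ), ∀ φ : ℂ → ℝ, ContDiffOn ℝ 2 φ (Metric.ball 0 1) →
      (∀ z ∈ Metric.ball (0 : ℂ) 1, c ≤ lap φ z ∧ lap φ z ≤ 1 / c) →
      ∃ H : ℂ → ℂ, DifferentiableOn ℂ H (Metric.ball 0 1) ∧ H 0 = 0 ∧
        ∀ z ∈ Metric.ball (0 : ℂ) 1, |(H z).re - φ z + φ 0| ≤ C := by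
  refine ⟨2 / c, by positivity, fun φ hφ hlap => ?_⟩
  set r : ℕ → ℝ := fun n => 1 - 1 / ((n : ℝ) + 2) with hr
  have hr0 : ∀ n, 0 < r n := fun n => by
    have : 1 / ((n : ℝ) + 2) < 1 := by
      rw [div_lt_one (by positivity)]
      linarith [n.cast_nonneg (α := ℝ)]
    simp only [hr]
    linarith
  have hr1 : ∀ n, r n < 1 := fun n => by
    have : 0 < 1 / ((n : ℝ) + 2) := by positivity
    simp only [hr]
    linarith
  have hrlim : Tendsto r atTop (𝓝 1) := by
    have h : Tendsto (fun n : ℕ => (1 : ℝ) / ((n : ℝ) + 2)) atTop (𝓝 0) :=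
      tendsto_const_nhds.div_atTop (tendsto_natCast_atTop_atTop.atTop_add tendsto_const_nhds)
    simpa [hr] using h.const_sub 1
  choose P hP hPφ using fun n =>
    exists_differentiable_re_approx_on_ball hc0 hc1 hφ hlap (hr0 n) (hr1 n)
  set Q : ℕ → ℂ → ℂ := fun n z => P n z - P n 0 with hQ
  have hQd : ∀ n, Differentiable ℂ (Q n) := fun n => (hP n).sub_const _
  have hQφ : ∀ n, ∀ z ∈ ball (0 : ℂ) (r n), |(Q n z).re - φ z + φ 0| ≤ 2 / c := by
    intro n z hz
    have h : (Q n z).re - φ z + φ 0 = ((P n z).re - φ z) - ((P n 0).re - φ 0) := by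
      simp only [hQ, Complex.sub_re]
      ring
    rw [h]
    refine (abs_sub _ _).trans ?_
    have h2 : 2 / c = 1 / c + 1 / c := by ring
    rw [h2]
    exact add_le_add (hPφ n z hz) (hPφ n 0 (mem_ball_self (hr0 n)))
  have hev : ∀ s < 1, ∀ᶠ n in (hyperfilter ℕ : Filter ℕ), s < r n := fun s hs =>
    (hrlim.mono_left Nat.hyperfilter_le_atTop).eventually (lt_mem_nhds hs)
  obtain ⟨H, hHd, hH⟩ := exists_differentiableOn_ultrafilter_limit (U := ball 0 1)
    (hyperfilter ℕ) hQd (fun z₀ hz₀ => by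
      have hz₀' : ‖z₀‖ < 1 := by simpa using hz₀
      set δ := (1 - ‖z₀‖) / 3 with hδ
      have hδ0 : 0 < δ := by rw [hδ]; linarith
      set R := ‖z₀‖ + 2 * δ with hR
      have hR0 : 0 < R := by positivity
      have hR1 : R < 1 := by rw [hR, hδ]; linarith
      obtain ⟨A, hA⟩ := (isCompact_closedBall (0 : ℂ) R).exists_bound_of_continuousOn
        (hφ.continuousOn.mono (closedBall_subset_ball hR1))
      set B := 2 * A + 2 / c with hB
      have hA0 : 0 ≤ A := (norm_nonneg _).trans (hA 0 (mem_closedBall_self hR0.le))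
      have hB0 : 0 < B := by positivity
      refine ⟨δ, hδ0, 2 * B * R / δ, (hev R hR1).mono fun n hn z hz => ?_⟩
      have hzn : ‖z‖ < ‖z₀‖ + δ := by
        have := norm_sub_norm_le z z₀
        rw [mem_ball, dist_eq_norm] at hz
        linarith
      have hzR : z ∈ ball (0 : ℂ) R := by
        rw [mem_ball_zero_iff]
        linarith
      refine (Complex.borelCaratheodory_zero hB0 (hQd n).differentiableOn (fun w hw => ?_) hR0 hzR
        (by simp [hQ])).trans ?_
      · have h1 := (abs_le.1 (hQφ n w (ball_subset_ball hn.le hw))).2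
        have h2 := (abs_le.1 (hA w (ball_subset_closedBall hw))).2
        have h3 := (abs_le.1 (hA 0 (mem_closedBall_self hR0.le))).1
        show (Q n w).re ≤ B
        linarith
      · have h1 : ‖z‖ ≤ R := by linarith
        have h2 : δ ≤ R - ‖z‖ := by linarith
        gcongr)
  refine ⟨H, hHd, ?_, fun z hz => ?_⟩
  · refine tendsto_nhds_unique (hH 0 (mem_ball_self one_pos)) ?_
    simp [hQ]
  · have hz' : ‖z‖ < 1 := by simpa using hz
    refine le_of_tendsto ((((Complex.continuous_re.tendsto _).comp (hH z hz)).sub_const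
      (φ z)).add_const (φ 0)).abs ?_
    filter_upwards [hev _ hz'] with n hn
    exact hQφ n z (by simpa using hn)
end
end
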